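/- For every δ ∈ (0,1) there exist a convex function G₀ : ℝ³ → ℝ which is differentiable with ∇G₀ Hölder continuous of exponent 1−δ on bounded sets, and two disjoint compact convex sets A₁, A₂ ⊂ ℝ³ with {∇u₀(x) : x ≠ 0, x₁² > x₂² + x₃²} ⊂ A₁ ∪ A₂, such that: G₀ is affine on A₁ and affine on A₂; G₀ is smooth with positive definite Hessian at every point of ℝ³ ∖ (A₁ ∪ A₂); and u₀ is a minimizer of ∫_{B₁} G₀(∇u₀) dx, i.e. ∫_{B₁} G₀(∇u₀ + ∇ψ) dx ≥ ∫_{B₁} G₀(∇u₀) dx for every ψ ∈ C_c^∞(B₁). -/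

import Mathlib

open Real Set Metric MeasureTheory
open scoped RealInnerProductSpace

noncomputable section

/-- `u₀(x) = (x₂² + x₃² − x₁²)/(√2·|x|)` (with value `0` at the origin, by `0`-division). -/
def u0 : EuclideanSpace ℝ (Fin 3) → ℝ :=
  fun x => ((x 1) ^ 2 + (x 2) ^ 2 - (x 0) ^ 2) / (Real.sqrt 2 * ‖x‖)

/-! ### One-dimensional profile functions -/

/-- clamped `1 - σ²` -/
def nS (σ : ℝ) : ℝ := max (1 - σ ^ 2) 0
def nM (σ : ℝ) : ℝ := (2 / 5) * (5 - 7 * nS σ + 3 * nS σ ^ 2) / (1 + nS σ)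
def nPhi (σ : ℝ) : ℝ := Real.exp (-(3 / 5) * (1 - nS σ)) / (1 + nS σ) ^ 3
def nChi (σ : ℝ) : ℝ := nS σ * nPhi σ
def nT (k σ : ℝ) : ℝ := 1 + (4 * k / 5 - 1) * (1 - nS σ) + (2 * k / 5) * (1 - nS σ) ^ 2
def nXi (k σ : ℝ) : ℝ := k * σ / nT k σ
def nOm (k σ : ℝ) : ℝ := nChi σ ^ (k - 1) * nPhi σ * nM σ * nT k σ
def nX (k σ : ℝ) : ℝ := nChi σ ^ k
def nY (σ : ℝ) : ℝ := (1 - σ ^ 2) ^ 2 * (7 + 2 * σ ^ 2) / 20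
def nZs (σ : ℝ) : ℝ := -(σ * (3 - σ ^ 2) / 2)
def nZ (k σ : ℝ) : ℝ := ∫ t in (0 : ℝ)..σ, -nOm k t
def nD (k σ : ℝ) : ℝ := ∫ t in (0 : ℝ)..σ, -(nOm k t * (nXi k t * (3 / 5 - nY t) + nZs t))
def nQ (k σ : ℝ) : ℝ := ∫ t in (1 : ℝ)..σ, -(nOm k t * (k * t - nXi k t))

lemma nS_nonneg (σ : ℝ) : 0 ≤ nS σ := le_max_right _ _
lemma nS_le_one (σ : ℝ) : nS σ ≤ 1 := max_le (by nlinarith [sq_nonneg σ]) zero_le_one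
lemma nS_cont : Continuous nS := by unfold nS; fun_prop
lemma nS_eq {σ : ℝ} (h : |σ| ≤ 1) : nS σ = 1 - σ ^ 2 := by
  unfold nS
  apply max_eq_left
  have := sq_le_one_iff_abs_le_one σ |>.2 h
  linarith
lemma nS_eq_zero {σ : ℝ} (h : 1 ≤ |σ|) : nS σ = 0 := by
  unfold nS
  apply max_eq_right
  have := one_le_sq_iff_one_le_abs σ |>.2 h
  linarith
lemma nS_pos {σ : ℝ} (h : |σ| < 1) : 0 < nS σ := by
  rw [nS_eq h.le]
  have := sq_lt_one_iff_abs_lt_one σ |>.2 h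
  linarith
lemma nS_even (σ : ℝ) : nS (-σ) = nS σ := by unfold nS; simp

lemma nS_deriv {σ : ℝ} (h : |σ| < 1) : HasDerivAt nS (-2 * σ) σ := by
  have h1 : HasDerivAt (fun t : ℝ => 1 - t ^ 2) (-2 * σ) σ := by
    have := (hasDerivAt_pow 2 σ).const_sub 1
    exact this.congr_deriv (by norm_num)
  apply h1.congr_of_eventuallyEq
  have : ∀ᶠ t in nhds σ, |t| < 1 := (isOpen_lt continuous_abs continuous_const).mem_nhds h
  filter_upwards [this] with t ht using nS_eq ht.le

lemma nM_pos (σ : ℝ) : 0 < nM σ := by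
  have := nS_nonneg σ
  unfold nM
  apply div_pos _ (by linarith)
  nlinarith [sq_nonneg (6 * nS σ - 7)]
lemma nM_le (σ : ℝ) : nM σ ≤ 2 := by
  have := nS_nonneg σ
  have := nS_le_one σ
  unfold nM
  rw [div_le_iff₀ (by linarith)]
  nlinarith
lemma nM_cont : Continuous nM := by
  unfold nM
  have := nS_cont
  apply Continuous.div (by fun_prop) (by fun_prop)
  intro x; have := nS_nonneg x; linarith
lemma nPhi_pos (σ : ℝ) : 0 < nPhi σ := by
  have := nS_nonneg σ
  unfold nPhi; positivity
lemma nPhi_le (σ : ℝ) : nPhi σ ≤ 1 := by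
  have := nS_nonneg σ
  have h1 := nS_le_one σ
  unfold nPhi
  rw [div_le_one (by positivity)]
  calc Real.exp (-(3 / 5) * (1 - nS σ)) ≤ 1 := Real.exp_le_one_iff.2 (by nlinarith)
    _ ≤ _ := one_le_pow₀ (by linarith)
lemma nPhi_cont : Continuous nPhi := by
  unfold nPhi
  have := nS_cont
  apply Continuous.div (by fun_prop) (by fun_prop)
  intro x; have := nS_nonneg x; positivity
lemma nChi_nonneg (σ : ℝ) : 0 ≤ nChi σ := mul_nonneg (nS_nonneg σ) (nPhi_pos σ).le
lemma nChi_le (σ : ℝ) : nChi σ ≤ nS σ :=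
  mul_le_of_le_one_right (nS_nonneg σ) (nPhi_le σ)
lemma nChi_le_one (σ : ℝ) : nChi σ ≤ 1 := (nChi_le σ).trans (nS_le_one σ)
lemma nChi_cont : Continuous nChi := nS_cont.mul nPhi_cont
lemma nChi_pos {σ : ℝ} (h : |σ| < 1) : 0 < nChi σ := mul_pos (nS_pos h) (nPhi_pos σ)
lemma nChi_eq_zero {σ : ℝ} (h : 1 ≤ |σ|) : nChi σ = 0 := by simp [nChi, nS_eq_zero h]

lemma nChi_deriv {σ : ℝ} (h : |σ| < 1) : HasDerivAt nChi (-(σ * nM σ * nPhi σ)) σ := by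
  have h1 := nS_deriv h
  have h0 := nS_nonneg σ
  have h2 : HasDerivAt nPhi _ σ :=
    (((h1.const_sub 1).const_mul (-(3 / 5))).exp).div ((h1.const_add 1).pow 3) (by positivity)
  have h3 := h1.mul h2
  refine h3.congr_deriv ?_
  have h5 : (1 + nS σ) ≠ 0 := by positivity
  simp only [nM, nPhi]
  field_simp
  ring

lemma nT_ge {k : ℝ} (hk : 5 / 2 ≤ k) (σ : ℝ) : 1 ≤ nT k σ := by
  have := nS_le_one σ
  unfold nT
  have h1 : 0 ≤ (4 * k / 5 - 1) * (1 - nS σ) := mul_nonneg (by linarith) (by linarith)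
  have h2 : 0 ≤ (2 * k / 5) * (1 - nS σ) ^ 2 := by positivity
  linarith
lemma nT_le {k : ℝ} (hk : 5 / 2 ≤ k) (hk3 : k < 3) (σ : ℝ) : nT k σ ≤ 18 / 5 := by
  have h0 := nS_le_one σ
  have h1 := nS_nonneg σ
  unfold nT
  have h1 : (4 * k / 5 - 1) * (1 - nS σ) ≤ (4 * k / 5 - 1) * 1 :=
    mul_le_mul_of_nonneg_left (by linarith) (by linarith)
  have h2 : (2 * k / 5) * (1 - nS σ) ^ 2 ≤ (2 * k / 5) * 1 :=
    mul_le_mul_of_nonneg_left (by nlinarith) (by linarith)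
  linarith
lemma nT_cont (k : ℝ) : Continuous (nT k) := by
  unfold nT
  have := nS_cont
  fun_prop
lemma nT_deriv (k : ℝ) {σ : ℝ} (h : |σ| < 1) : HasDerivAt (nT k)
    ((4 * k / 5 - 1) * (2 * σ) + (2 * k / 5) * (2 * (1 - nS σ) * (2 * σ))) σ := by
  have h1 := nS_deriv h
  have h3 := (((h1.const_sub 1).const_mul (4 * k / 5 - 1)).const_add 1).add
    (((h1.const_sub 1).pow 2).const_mul (2 * k / 5))
  refine h3.congr_deriv ?_
  norm_num
lemma nXi_cont {k : ℝ} (hk : 5 / 2 ≤ k) : Continuous (nXi k) := by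
  unfold nXi
  apply Continuous.div (by fun_prop) (nT_cont k)
  intro x; have := nT_ge hk x; linarith
lemma nOm_cont {k : ℝ} (hk : 5 / 2 ≤ k) : Continuous (nOm k) := by
  unfold nOm
  have h1 : Continuous (fun σ => nChi σ ^ (k - 1)) :=
    nChi_cont.rpow_const (fun x => Or.inr (by linarith))
  exact ((h1.mul nPhi_cont).mul nM_cont).mul (nT_cont k)
lemma nOm_nonneg {k : ℝ} (hk : 5 / 2 ≤ k) (σ : ℝ) : 0 ≤ nOm k σ := by
  have h1 := nT_ge hk σ
  have h2 := nM_pos σ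
  have h3 := nPhi_pos σ
  have h4 := Real.rpow_nonneg (nChi_nonneg σ) (k - 1)
  unfold nOm
  have : 0 ≤ nT k σ := by linarith
  positivity
lemma nOm_pos {k : ℝ} (hk : 5 / 2 ≤ k) {σ : ℝ} (h : |σ| < 1) : 0 < nOm k σ := by
  have h1 := nT_ge hk σ
  have h2 := nM_pos σ
  have h3 := nPhi_pos σ
  have h4 := Real.rpow_pos_of_pos (nChi_pos h) (k - 1)
  unfold nOm
  have : 0 < nT k σ := by linarith
  positivity
lemma nOm_le {k : ℝ} (hk : 5 / 2 ≤ k) (hk3 : k < 3) (σ : ℝ) :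
    nOm k σ ≤ 8 * nChi σ ^ (k - 1) := by
  have h1 := nT_ge hk σ
  have h1b := nT_le hk hk3 σ
  have h2 := nM_pos σ
  have h2b := nM_le σ
  have h3 := nPhi_pos σ
  have h3b := nPhi_le σ
  have h4 := Real.rpow_nonneg (nChi_nonneg σ) (k - 1)
  unfold nOm
  have e : nPhi σ * nM σ * nT k σ ≤ 1 * 2 * (18 / 5) := by gcongr
  calc _ = nChi σ ^ (k - 1) * (nPhi σ * nM σ * nT k σ) := by ring
    _ ≤ nChi σ ^ (k - 1) * 8 := mul_le_mul_of_nonneg_left (by linarith) h4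
    _ = _ := by ring
lemma nOm_eq_zero {k : ℝ} (hk : 5 / 2 ≤ k) {σ : ℝ} (h : 1 ≤ |σ|) : nOm k σ = 0 := by
  unfold nOm
  rw [nChi_eq_zero h, Real.zero_rpow (by linarith)]; simp
lemma nX_eq_zero {k : ℝ} (hk : 5 / 2 ≤ k) {σ : ℝ} (h : 1 ≤ |σ|) : nX k σ = 0 := by
  unfold nX
  rw [nChi_eq_zero h, Real.zero_rpow (by linarith)]
lemma nX_cont {k : ℝ} (hk : 5 / 2 ≤ k) : Continuous (nX k) :=
  nChi_cont.rpow_const (fun x => Or.inr (by linarith))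
lemma nX_nonneg (k σ : ℝ) : 0 ≤ nX k σ := Real.rpow_nonneg (nChi_nonneg σ) _
lemma nX_pos (k : ℝ) {σ : ℝ} (h : |σ| < 1) : 0 < nX k σ := Real.rpow_pos_of_pos (nChi_pos h) _
lemma nX_le_one {k : ℝ} (hk : 5 / 2 ≤ k) (σ : ℝ) : nX k σ ≤ 1 :=
  Real.rpow_le_one (nChi_nonneg σ) (nChi_le_one σ) (by linarith)

lemma nX_deriv_in {k : ℝ} (hk : 5 / 2 ≤ k) {σ : ℝ} (h : |σ| < 1) :
    HasDerivAt (nX k) (-(nOm k σ * nXi k σ)) σ := by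
  have h1 := (nChi_deriv h).rpow_const (p := k) (Or.inl (nChi_pos h).ne')
  refine h1.congr_deriv ?_
  have := nT_ge hk σ
  unfold nOm nXi
  have h3 : nT k σ ≠ 0 := by linarith
  field_simp

lemma abs_lt_one_open {σ : ℝ} (h : |σ| < 1) : ∀ᶠ t in nhds σ, |t| < 1 :=
  (isOpen_lt continuous_abs continuous_const).mem_nhds h

lemma nX_deriv {k : ℝ} (hk : 5 / 2 ≤ k) (σ : ℝ) :
    HasDerivAt (nX k) (-(nOm k σ * nXi k σ)) σ := by
  have hne : ∀ τ : ℝ, |τ| ≠ 1 → HasDerivAt (nX k) (-(nOm k τ * nXi k τ)) τ := by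
    intro τ hτ
    rcases lt_or_gt_of_ne hτ with h | h
    · exact nX_deriv_in hk h
    · rw [nOm_eq_zero hk h.le]
      have h0 : HasDerivAt (fun _ : ℝ => (0 : ℝ)) (-(0 * nXi k τ)) τ := by
        simpa using hasDerivAt_const τ (0 : ℝ)
      apply h0.congr_of_eventuallyEq
      have : ∀ᶠ t in nhds τ, 1 < |t| := (isOpen_lt continuous_const continuous_abs).mem_nhds h
      filter_upwards [this] with t ht using nX_eq_zero hk ht.le
  by_cases h : |σ| = 1
  · have hc : Continuous (fun τ => -(nOm k τ * nXi k τ)) :=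
      ((nOm_cont hk).mul (nXi_cont hk)).neg
    have hev : ∀ᶠ τ in nhds σ, τ ≠ -σ := by
      apply (isOpen_ne).mem_nhds
      intro h'
      have : σ = 0 := by linarith
      rw [this] at h
      simp at h
    have key : ∀ᶠ τ in nhdsWithin σ {σ}ᶜ, HasDerivAt (nX k) (-(nOm k τ * nXi k τ)) τ := by
      filter_upwards [self_mem_nhdsWithin, nhdsWithin_le_nhds hev] with τ h1 h2
      apply hne
      intro h3
      rw [← h, abs_eq_abs] at h3
      rcases h3 with h3 | h3
      · exact h1 h3
      · exact h2 h3
    have kd : ∀ᶠ τ in nhdsWithin σ {σ}ᶜ, DifferentiableAt ℝ (nX k) τ :=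
      key.mono fun τ h => h.differentiableAt
    obtain ⟨s, hs, hss⟩ := (eventually_nhdsWithin_iff.1 key).exists_mem
    have h1 := hasDerivWithinAt_Ici_of_tendsto_deriv (s := s ∩ Ioi σ) (a := σ)
      (f := nX k) (e := -(nOm k σ * nXi k σ))
      (fun t ht => (hss t ht.1 (ne_of_gt ht.2)).differentiableAt.differentiableWithinAt)
      (nX_cont hk).continuousWithinAt
      (Filter.inter_mem (mem_nhdsWithin_of_mem_nhds hs) self_mem_nhdsWithin) (by
        have : Filter.Tendsto (fun τ => -(nOm k τ * nXi k τ)) (nhdsWithin σ (Ioi σ))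
          (nhds (-(nOm k σ * nXi k σ))) := hc.continuousWithinAt
        refine this.congr' ?_
        filter_upwards [mem_nhdsWithin_of_mem_nhds hs, self_mem_nhdsWithin] with t h1 h2
        exact (hss t h1 (ne_of_gt h2)).deriv.symm)
    have h2 := hasDerivWithinAt_Iic_of_tendsto_deriv (s := s ∩ Iio σ) (a := σ)
      (f := nX k) (e := -(nOm k σ * nXi k σ))
      (fun t ht => (hss t ht.1 (ne_of_lt ht.2)).differentiableAt.differentiableWithinAt)
      (nX_cont hk).continuousWithinAt
      (Filter.inter_mem (mem_nhdsWithin_of_mem_nhds hs) self_mem_nhdsWithin) (by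
        have : Filter.Tendsto (fun τ => -(nOm k τ * nXi k τ)) (nhdsWithin σ (Iio σ))
          (nhds (-(nOm k σ * nXi k σ))) := hc.continuousWithinAt
        refine this.congr' ?_
        filter_upwards [mem_nhdsWithin_of_mem_nhds hs, self_mem_nhdsWithin] with t h1 h2
        exact (hss t h1 (ne_of_lt h2)).deriv.symm)
    have h3 := h1.union h2
    rwa [Ici_union_Iic, hasDerivWithinAt_univ] at h3
  · exact hne σ h

lemma primitive_deriv {f : ℝ → ℝ} (hf : Continuous f) (a σ : ℝ) :
    HasDerivAt (fun s => ∫ t in a..s, f t) (f σ) σ :=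
  intervalIntegral.integral_hasDerivAt_right (hf.intervalIntegrable _ _)
    (hf.stronglyMeasurableAtFilter _ _) hf.continuousAt

lemma nZ_deriv {k : ℝ} (hk : 5 / 2 ≤ k) (σ : ℝ) : HasDerivAt (nZ k) (-nOm k σ) σ :=
  primitive_deriv (nOm_cont hk).neg 0 σ
lemma nY_cont : Continuous nY := by unfold nY; fun_prop
lemma nZs_cont : Continuous nZs := by unfold nZs; fun_prop
lemma nD_deriv {k : ℝ} (hk : 5 / 2 ≤ k) (σ : ℝ) :
    HasDerivAt (nD k) (-(nOm k σ * (nXi k σ * (3 / 5 - nY σ) + nZs σ))) σ :=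
  primitive_deriv (f := fun t => -(nOm k t * (nXi k t * (3 / 5 - nY t) + nZs t)))
    (((nOm_cont hk).mul (((nXi_cont hk).mul (continuous_const.sub nY_cont)).add nZs_cont)).neg) 0 σ
lemma nQ_deriv {k : ℝ} (hk : 5 / 2 ≤ k) (σ : ℝ) :
    HasDerivAt (nQ k) (-(nOm k σ * (k * σ - nXi k σ))) σ :=
  primitive_deriv (f := fun t => -(nOm k t * (k * t - nXi k t)))
    (((nOm_cont hk).mul ((continuous_const.mul continuous_id).sub (nXi_cont hk))).neg) 1 σ
lemma nQ_one (k : ℝ) : nQ k 1 = 0 := by simp [nQ]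
lemma nOm_even (k σ : ℝ) : nOm k (-σ) = nOm k σ := by
  simp [nOm, nChi, nPhi, nM, nT, nS_even]
lemma nXi_odd (k σ : ℝ) : nXi k (-σ) = -nXi k σ := by
  simp [nXi, nT, nS_even, neg_div]
lemma nQ_neg_one (k : ℝ) : nQ k (-1) = 0 := by
  unfold nQ
  have h := intervalIntegral.integral_comp_neg (a := 1) (b := -1)
    (fun t => -(nOm k t * (k * t - nXi k t)))
  simp only [nOm_even, nXi_odd, neg_neg] at h
  have h2 : (∫ x in (1 : ℝ)..(-1), -(nOm k x * (k * -x - -nXi k x))) =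
      -∫ x in (1 : ℝ)..(-1), -(nOm k x * (k * x - nXi k x)) := by
    rw [← intervalIntegral.integral_neg]; congr 1; ext x; ring
  rw [h2] at h
  linarith
lemma nZ_cont {k : ℝ} (hk : 5 / 2 ≤ k) : Continuous (nZ k) :=
  continuous_iff_continuousAt.2 fun σ => (nZ_deriv hk σ).continuousAt
lemma nD_cont {k : ℝ} (hk : 5 / 2 ≤ k) : Continuous (nD k) :=
  continuous_iff_continuousAt.2 fun σ => (nD_deriv hk σ).continuousAt
lemma nQ_cont {k : ℝ} (hk : 5 / 2 ≤ k) : Continuous (nQ k) :=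
  continuous_iff_continuousAt.2 fun σ => (nQ_deriv hk σ).continuousAt

/-- `ξ̂ - ξ = c σ` with `0 ≤ c ≤ k`. -/
lemma nGap {k : ℝ} (hk : 5 / 2 ≤ k) (σ : ℝ) :
    k * σ - nXi k σ = nXi k σ * (nT k σ - 1) := by
  have := nT_ge hk σ
  unfold nXi
  have h3 : nT k σ ≠ 0 := by linarith
  field_simp

lemma nQ_combo {k : ℝ} (hk : 5 / 2 ≤ k) (hk3 : k < 3) (a : ℝ → ℝ) (f : ℝ → ℝ)
    (hf : ∀ σ, HasDerivAt f (-(nXi k σ * a σ)) σ) (ha : ∀ σ, 0 ≤ a σ)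
    (h1 : f 1 = 0) (h2 : f (-1) = 0) {σ : ℝ} (h : |σ| ≤ 1) : 0 ≤ f σ := by
  have hc : Continuous f := continuous_iff_continuousAt.2 fun σ => (hf σ).continuousAt
  obtain ⟨hl, hr⟩ := abs_le.1 h
  have hxi : ∀ t, 0 ≤ t → 0 ≤ nXi k t := by
    intro t ht
    have := nT_ge hk t
    unfold nXi
    exact div_nonneg (by nlinarith) (by linarith)
  have hxi' : ∀ t, t ≤ 0 → nXi k t ≤ 0 := by
    intro t ht
    have := hxi (-t) (by linarith)
    rw [nXi_odd] at this; linarith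
  rcases le_total 0 σ with h0 | h0
  · have : AntitoneOn f (Icc 0 1) := by
      apply antitoneOn_of_deriv_nonpos (convex_Icc 0 1) hc.continuousOn
        (fun t _ => (hf t).differentiableAt.differentiableWithinAt)
      intro t ht
      rw [interior_Icc] at ht
      rw [(hf t).deriv]
      have := mul_nonneg (hxi t ht.1.le) (ha t)
      linarith
    have := this ⟨h0, hr⟩ ⟨zero_le_one, le_rfl⟩ hr
    linarith
  · have : MonotoneOn f (Icc (-1) 0) := by
      apply monotoneOn_of_deriv_nonneg (convex_Icc _ _) hc.continuousOn
        (fun t _ => (hf t).differentiableAt.differentiableWithinAt)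
      intro t ht
      rw [interior_Icc] at ht
      rw [(hf t).deriv]
      have := mul_nonneg (neg_nonneg.2 (hxi' t ht.2.le)) (ha t)
      linarith
    have := this ⟨le_rfl, by norm_num⟩ ⟨hl, h0⟩ hl
    linarith

lemma nQ_nonneg {k : ℝ} (hk : 5 / 2 ≤ k) (hk3 : k < 3) {σ : ℝ} (h : |σ| ≤ 1) :
    0 ≤ nQ k σ := by
  refine nQ_combo hk hk3 (fun σ => nOm k σ * (nT k σ - 1)) (nQ k) ?_ ?_
    (nQ_one k) (nQ_neg_one k) h
  · intro σ
    refine (nQ_deriv hk σ).congr_deriv ?_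
    rw [nGap hk]; ring
  · intro σ
    exact mul_nonneg (nOm_nonneg hk σ) (by linarith [nT_ge hk σ])
lemma nQ_le {k : ℝ} (hk : 5 / 2 ≤ k) (hk3 : k < 3) {σ : ℝ} (h : |σ| ≤ 1) :
    nQ k σ ≤ 3 * nX k σ := by
  have := nQ_combo hk hk3 (fun σ => nOm k σ * (4 - nT k σ)) (fun σ => 3 * nX k σ - nQ k σ) ?_ ?_
    (by simp [nQ_one, nX_eq_zero hk]) (by simp [nQ_neg_one, nX_eq_zero hk]) h
  · linarith
  · intro σ
    refine (((nX_deriv hk σ).const_mul 3).sub (nQ_deriv hk σ)).congr_deriv ?_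
    rw [nGap hk]; ring
  · intro σ
    exact mul_nonneg (nOm_nonneg hk σ) (by linarith [nT_le hk hk3 σ])

/-! ### The glue functions -/

def ge (r E : ℝ) : ℝ := if r ≤ 0 then 0 else Real.exp (-(E / r))
def gJ (r E : ℝ) : ℝ := r * ge r E
def gJr (r E : ℝ) : ℝ := ge r E * (1 + E / r)

lemma ge_of_nonpos {r : ℝ} (h : r ≤ 0) (E : ℝ) : ge r E = 0 := by simp [ge, h]
lemma ge_of_pos {r : ℝ} (h : 0 < r) (E : ℝ) : ge r E = Real.exp (-(E / r)) := by
  simp [ge, not_le.2 h]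
lemma ge_nonneg (r E : ℝ) : 0 ≤ ge r E := by unfold ge; split_ifs <;> positivity
lemma ge_le_one (r : ℝ) {E : ℝ} (hE : 0 ≤ E) : ge r E ≤ 1 := by
  unfold ge
  split_ifs with h
  · exact zero_le_one
  · have : 0 ≤ E / r := div_nonneg hE (by linarith)
    exact Real.exp_le_one_iff.2 (by linarith)
lemma gJ_nonneg (r E : ℝ) : 0 ≤ gJ r E := by
  unfold gJ
  rcases le_or_gt r 0 with h | h
  · simp [ge_of_nonpos h]
  · exact mul_nonneg h.le (ge_nonneg _ _)
lemma gJ_of_nonpos {r : ℝ} (h : r ≤ 0) (E : ℝ) : gJ r E = 0 := by simp [gJ, ge_of_nonpos h]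
lemma gJr_of_nonpos {r : ℝ} (h : r ≤ 0) (E : ℝ) : gJr r E = 0 := by simp [gJr, ge_of_nonpos h]
lemma gJr_nonneg (r : ℝ) {E : ℝ} (hE : 0 ≤ E) : 0 ≤ gJr r E := by
  unfold gJr
  rcases le_or_gt r 0 with h | h
  · simp [ge_of_nonpos h]
  · have := ge_nonneg r E
    positivity
lemma gJr_le_one (r : ℝ) {E : ℝ} (hE : 0 ≤ E) : gJr r E ≤ 1 := by
  unfold gJr
  rcases le_or_gt r 0 with h | h
  · simp [ge_of_nonpos h]
  · rw [ge_of_pos h, Real.exp_neg, inv_mul_le_iff₀ (Real.exp_pos _), mul_one, add_comm]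
    exact Real.add_one_le_exp _

lemma gJ_subgrad (r r' : ℝ) {E : ℝ} (hE : 0 ≤ E) :
    gJ r E + gJr r E * (r' - r) ≤ gJ r' E := by
  rcases le_or_gt r 0 with h | h
  · simp [gJ_of_nonpos h, gJr_of_nonpos h, gJ_nonneg]
  · have key : gJ r E + gJr r E * (r' - r) = ge r E * (r' * (1 + E / r) - E) := by
      unfold gJ gJr; field_simp; ring
    rw [key]
    rcases le_or_gt r' 0 with h' | h'
    · rw [gJ_of_nonpos h']
      apply mul_nonpos_of_nonneg_of_nonpos (ge_nonneg _ _)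
      have : 0 ≤ 1 + E / r := by positivity
      nlinarith
    · unfold gJ
      rw [ge_of_pos h, ge_of_pos h']
      have h1 : Real.exp (-(E / r')) = Real.exp (-(E / r)) * Real.exp (E / r - E / r') := by
        rw [← Real.exp_add]; congr 1; ring
      have h2 := Real.add_one_le_exp (E / r - E / r')
      rw [h1]
      have h3 : r' * (1 + E / r) - E = r' * (E / r - E / r' + 1) := by field_simp; ring
      rw [h3]
      have h4 := Real.exp_pos (-(E / r))
      calc _ ≤ Real.exp (-(E / r)) * (r' * Real.exp (E / r - E / r')) := by gcongr
        _ = _ := by ring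

lemma gJ_lip (r r' : ℝ) {E : ℝ} (hE : 0 ≤ E) : |gJ r E - gJ r' E| ≤ |r - r'| := by
  have aux : ∀ a b : ℝ, gJ a E - gJ b E ≤ |a - b| := by
    intro a b
    have h1 := gJ_subgrad a b hE
    have h2 := gJr_nonneg a hE
    have h3 := gJr_le_one a hE
    have h4 : gJr a E * (a - b) ≤ |a - b| := by
      calc gJr a E * (a - b) ≤ gJr a E * |a - b| := by gcongr; exact le_abs_self _
        _ ≤ 1 * |a - b| := by gcongr
        _ = _ := one_mul _
    linarith
  rw [abs_le]
  have := aux r r'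
  have h2 := aux r' r
  rw [abs_sub_comm] at h2
  constructor <;> linarith

lemma ge_eq_glue (r : ℝ) {E : ℝ} (hE : 0 < E) : ge r E = expNegInvGlue (r / E) := by
  unfold ge expNegInvGlue
  by_cases h : r ≤ 0
  · rw [if_pos h, if_pos (div_nonpos_of_nonpos_of_nonneg h hE.le)]
  · rw [if_neg h, if_neg (not_le.2 (div_pos (not_le.1 h) hE)), inv_div]

lemma glue_bound (y : ℝ) (n : ℕ) : |(y⁻¹) ^ n * expNegInvGlue y| ≤ n.factorial := by
  rcases le_or_gt y 0 with h | h
  · rw [expNegInvGlue.zero_of_nonpos h]; simp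
  · have h1 : expNegInvGlue y = Real.exp (-y⁻¹) := by
      unfold expNegInvGlue; rw [if_neg (not_le.2 h)]
    have h2 := Real.pow_div_factorial_le_exp (y⁻¹) (by positivity) n
    rw [h1, abs_of_nonneg (by positivity), Real.exp_neg, ← div_eq_mul_inv, div_le_iff₀ (Real.exp_pos _)]
    rwa [div_le_iff₀' (by positivity)] at h2

lemma glue_deriv (y : ℝ) : HasDerivAt expNegInvGlue ((y⁻¹) ^ 2 * expNegInvGlue y) y := by
  have h := expNegInvGlue.hasDerivAt_polynomial_eval_inv_mul 1 y
  simpa using h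

lemma glue1_deriv (y : ℝ) :
    HasDerivAt (fun y => (1 + y⁻¹) * expNegInvGlue y) ((y⁻¹) ^ 3 * expNegInvGlue y) y := by
  have h := expNegInvGlue.hasDerivAt_polynomial_eval_inv_mul (1 + Polynomial.X) y
  simp at h
  refine h.congr_deriv ?_
  ring

lemma lip_of_deriv {f f' : ℝ → ℝ} (h : ∀ x, HasDerivAt f (f' x) x) {C : ℝ}
    (hC : ∀ x, |f' x| ≤ C) (a b : ℝ) : |f a - f b| ≤ C * |a - b| := by
  have := Convex.norm_image_sub_le_of_norm_hasDerivWithin_le (s := univ) (f := f) (f' := f')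
    (fun x _ => (h x).hasDerivWithinAt) (fun x _ => hC x) convex_univ (mem_univ b) (mem_univ a)
  simpa using this

lemma ge_lip (r r' : ℝ) {E : ℝ} (hE : 0 ≤ E) : E * |ge r E - ge r' E| ≤ 2 * |r - r'| := by
  rcases hE.eq_or_lt with h | h
  · rw [← h]; simp
  · rw [ge_eq_glue r h, ge_eq_glue r' h]
    have := lip_of_deriv glue_deriv (C := 2) (fun y => by
      have := glue_bound y 2
      norm_num at this ⊢; exact this) (r / E) (r' / E)
    rw [← sub_div, abs_div, abs_of_pos h] at this
    calc _ ≤ E * (2 * (|r - r'| / E)) := by gcongr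
      _ = _ := by field_simp

lemma gJr_lip (r r' : ℝ) {E : ℝ} (hE : 0 ≤ E) : E * |gJr r E - gJr r' E| ≤ 6 * |r - r'| := by
  rcases hE.eq_or_lt with h | h
  · rw [← h]; simp
  · have e : ∀ r, gJr r E = (1 + (r / E)⁻¹) * expNegInvGlue (r / E) := by
      intro r
      rw [gJr, ge_eq_glue r h, inv_div, mul_comm]
    rw [e, e]
    have := lip_of_deriv glue1_deriv (C := 6) (fun y => by
      have := glue_bound y 3
      norm_num [Nat.factorial] at this ⊢; exact this) (r / E) (r' / E)
    rw [← sub_div, abs_div, abs_of_pos h] at this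
    calc _ ≤ E * (6 * (|r - r'| / E)) := by gcongr
      _ = _ := by field_simp

/-! ### `F` and `Θ` -/

def nE (k σ : ℝ) : ℝ := (3 - k) / 10000 * nChi σ ^ 3
def nH (k σ : ℝ) : ℝ := 3 * ((3 - k) / 10000) * (σ / nT k σ) * (nChi σ ^ (3 - k) * nQ k σ)
def nTh (k Z r σ : ℝ) : ℝ :=
  Z - nZs σ + nXi k σ * (r + nY σ) + (k * σ - nXi k σ) * gJ r (nE k σ) - nH k σ * ge r (nE k σ)
def nF (k Z r σ : ℝ) : ℝ :=
  nZ k σ * Z + nX k σ * (r + 3 / 5) - nD k σ + nQ k σ * gJ r (nE k σ)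

lemma nE_nonneg {k : ℝ} (hk3 : k < 3) (σ : ℝ) : 0 ≤ nE k σ := by
  have := nChi_nonneg σ
  have : 0 < 3 - k := by linarith
  unfold nE; positivity
lemma nE_pos {k : ℝ} (hk3 : k < 3) {σ : ℝ} (h : |σ| < 1) : 0 < nE k σ := by
  have := nChi_pos h
  have : 0 < 3 - k := by linarith
  unfold nE; positivity
lemma nE_cont (k : ℝ) : Continuous (nE k) := by
  unfold nE
  have := nChi_cont
  fun_prop
lemma nE_deriv (k : ℝ) {σ : ℝ} (h : |σ| < 1) : HasDerivAt (nE k)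
    (-(3 * ((3 - k) / 10000) * nChi σ ^ 2 * (σ * nM σ * nPhi σ))) σ := by
  refine (((nChi_deriv h).pow 3).const_mul ((3 - k) / 10000)).congr_deriv ?_
  norm_num; ring

lemma nF_deriv {k : ℝ} (hk : 5 / 2 ≤ k) (Z r : ℝ) {σ : ℝ} (h : |σ| < 1) :
    HasDerivAt (nF k Z r) (-(nOm k σ * nTh k Z r σ)) σ := by
  have hb := ((nZ_deriv hk σ).mul_const Z).add ((nX_deriv hk σ).mul_const (r + 3 / 5)) |>.sub
    (nD_deriv hk σ)
  rcases le_or_gt r 0 with hr | hr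
  · have e : nF k Z r = fun σ => nZ k σ * Z + nX k σ * (r + 3 / 5) - nD k σ := by
      ext σ; simp [nF, gJ_of_nonpos hr]
    rw [e]
    refine hb.congr_deriv ?_
    simp only [nTh, gJ_of_nonpos hr, ge_of_nonpos hr]
    ring
  · have e : nF k Z r = fun σ => nZ k σ * Z + nX k σ * (r + 3 / 5) - nD k σ +
        nQ k σ * (r * Real.exp (-(nE k σ / r))) := by
      ext σ; simp [nF, gJ, ge_of_pos hr]
    rw [e]
    have hE := (((nE_deriv k h).div_const r).fun_neg.exp).const_mul r
    refine (hb.add ((nQ_deriv hk σ).mul hE)).congr_deriv ?_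
    simp only [nTh, gJ, ge_of_pos hr, nH]
    have hw : nChi σ ^ (k - 1) * nChi σ ^ (3 - k) = nChi σ ^ 2 := by
      rw [← Real.rpow_add (nChi_pos h)]
      norm_num
    have hT : nT k σ ≠ 0 := by have := nT_ge hk σ; linarith
    have hOH : nOm k σ * (3 * ((3 - k) / 10000) * (σ / nT k σ) * (nChi σ ^ (3 - k) * nQ k σ)) =
        3 * ((3 - k) / 10000) * σ * nPhi σ * nM σ * nQ k σ * nChi σ ^ 2 := by
      rw [← hw]; unfold nOm; field_simp
    have hr' : r ≠ 0 := hr.ne'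
    have e2 : r * (Real.exp (-(nE k σ / r)) * -(-(3 * ((3 - k) / 10000) * nChi σ ^ 2 * (σ * nM σ * nPhi σ)) / r))
      = Real.exp (-(nE k σ / r)) * (3 * ((3 - k) / 10000) * nChi σ ^ 2 * (σ * nM σ * nPhi σ)) := by
      field_simp
    rw [e2]
    linear_combination (Real.exp (-(nE k σ / r))) * (-hOH)

/-! ### Monotonicity of `Θ` -/

def nW (k u : ℝ) : ℝ := 1 - (4 * k / 5 - 1) * u - 3 * (2 * k / 5) * u ^ 2
def nTp (k u : ℝ) : ℝ := 1 + (4 * k / 5 - 1) * u + (2 * k / 5) * u ^ 2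

lemma nT_eq (k : ℝ) {σ : ℝ} (h : |σ| ≤ 1) : nT k σ = nTp k (σ ^ 2) := by
  unfold nT nTp; rw [nS_eq h]; ring

lemma nXi_deriv {k : ℝ} (hk : 5 / 2 ≤ k) {σ : ℝ} (h : |σ| < 1) :
    HasDerivAt (nXi k) (k * nW k (σ ^ 2) / nT k σ ^ 2) σ := by
  have hT : nT k σ ≠ 0 := by have := nT_ge hk σ; linarith
  refine (((hasDerivAt_id σ).const_mul k).div (nT_deriv k h) hT).congr_deriv ?_
  congr 1
  rw [nT_eq k h.le, nS_eq h.le]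
  simp only [nTp, nW, id]; ring

lemma nY_deriv (σ : ℝ) : HasDerivAt nY (-(3 / 5 * (1 - σ ^ 2) * σ * (2 + σ ^ 2))) σ := by
  have h := ((((hasDerivAt_pow 2 σ).const_sub 1).pow 2).mul
    (((hasDerivAt_pow 2 σ).const_mul 2).const_add 7)).div_const 20
  refine h.congr_deriv ?_
  norm_num; ring

lemma nZs_deriv (σ : ℝ) : HasDerivAt nZs (-(3 / 2 * (1 - σ ^ 2))) σ := by
  have h := (((hasDerivAt_id σ).mul ((hasDerivAt_pow 2 σ).const_sub 3)).div_const 2).neg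
  refine h.congr_deriv ?_
  norm_num; ring

lemma poly_I {k u : ℝ} (hk : 5 / 2 ≤ k) (hk3 : k < 3) (h0 : 0 ≤ u) (h1 : u ≤ 1) :
    (3 - k) ≤ k * nW k u * ((7 + 2 * u) / 20) + 3 / 2 * nTp k u := by
  unfold nW nTp
  have a1 : 0 ≤ 1 - u := by linarith
  have a2 : 0 ≤ 3 - k := by linarith
  have a3 : 0 ≤ k - 5 / 2 := by linarith
  nlinarith [mul_nonneg h0 a1, mul_nonneg h0 a2, mul_nonneg a1 a2, mul_nonneg (mul_nonneg h0 a1) a2,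
    mul_nonneg (mul_nonneg h0 a1) a3, mul_nonneg (mul_nonneg h0 a2) a3, mul_nonneg a2 a3,
    mul_nonneg (mul_nonneg (mul_nonneg h0 h0) a1) a2, mul_nonneg (mul_nonneg (mul_nonneg h0 h0) a1) a3,
    mul_nonneg (mul_nonneg (mul_nonneg h0 h0) a2) a3,
    mul_nonneg (mul_nonneg (mul_nonneg h0 h0) (mul_nonneg h0 a2)) a3,
    mul_nonneg (mul_nonneg h0 h0) a1, mul_nonneg (mul_nonneg h0 a2) a2]

lemma poly_II {k u : ℝ} (hk : 5 / 2 ≤ k) (hk3 : k < 3) (h0 : 0 ≤ u) (h1 : u ≤ 1) :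
    (3 - k) * (1 - u) ^ 2 ≤ k * nW k u * ((1 - u) ^ 2 * ((7 + 2 * u) / 20) - 3 / 5)
      + 3 / 2 * (1 - u) ^ 2 * nTp k u := by
  unfold nW nTp
  have a1 : 0 ≤ 1 - u := by linarith
  have a2 : 0 ≤ 3 - k := by linarith
  have a3 : 0 ≤ k - 5 / 2 := by linarith
  have hp : ∀ i j : ℕ, 0 ≤ u ^ i * (1 - u) ^ (5 - i) * ((k - 5 / 2) ^ j * (3 - k) ^ (2 - j)) :=
    fun i j => by positivity
  linarith [hp 0 0, hp 0 1, hp 0 2, hp 1 0, hp 1 1, hp 1 2, hp 2 0, hp 2 1, hp 2 2, hp 3 0, hp 3 1, hp 3 2, hp 4 0, hp 4 1, hp 4 2, hp 5 0, hp 5 1, hp 5 2]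

/-- the lower bound for `∂_σ Θ` when `r ≤ 0` -/
lemma base_bound {k u r : ℝ} (hk : 5 / 2 ≤ k) (hk3 : k < 3) (h0 : 0 ≤ u) (h1 : u ≤ 1)
    (hr : -(3 / 5) ≤ r) (hr0 : r ≤ 0) :
    (3 - k) * (1 - u) ^ 2 ≤ k * nW k u * (r + (1 - u) ^ 2 * (7 + 2 * u) / 20)
      + 3 / 2 * (1 - u) ^ 2 * nTp k u := by
  have hI := poly_I hk hk3 h0 h1
  have hII := poly_II hk hk3 h0 h1
  have hs : 0 ≤ (1 - u) ^ 2 := sq_nonneg _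
  have hI' := mul_le_mul_of_nonneg_left hI hs
  nlinarith [mul_le_mul_of_nonneg_left hI' (show 0 ≤ 1 + 5 / 3 * r by linarith),
    mul_le_mul_of_nonneg_left hII (show 0 ≤ -(5 / 3 * r) by linarith)]

lemma nT_sq_le {k : ℝ} (hk : 5 / 2 ≤ k) (hk3 : k < 3) (σ : ℝ) : nT k σ ^ 2 ≤ 13 := by
  nlinarith [nT_ge hk σ, nT_le hk hk3 σ]

/-- the part of `Θ` without glue -/
lemma nBase_deriv {k : ℝ} (hk : 5 / 2 ≤ k) (Z r : ℝ) {σ : ℝ} (h : |σ| < 1) :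
    HasDerivAt (fun σ => Z - nZs σ + nXi k σ * (r + nY σ))
      ((k * nW k (σ ^ 2) * (r + (1 - σ ^ 2) ^ 2 * (7 + 2 * σ ^ 2) / 20)
      + 3 / 2 * (1 - σ ^ 2) ^ 2 * nTp k (σ ^ 2)) / nT k σ ^ 2) σ := by
  refine (((nZs_deriv σ).const_sub Z).add ((nXi_deriv hk h).mul ((nY_deriv σ).const_add r))).congr_deriv ?_
  have hT : nT k σ ≠ 0 := by have := nT_ge hk σ; linarith
  rw [← nT_eq k h.le, nY, nXi]
  field_simp
  rw [nT_eq k h.le]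
  unfold nTp
  ring

lemma nBase_deriv_ge {k : ℝ} (hk : 5 / 2 ≤ k) (hk3 : k < 3) {r σ : ℝ} (h : |σ| < 1)
    (hr : -(3 / 5) ≤ r) (hr0 : r ≤ 0) :
    (3 - k) / 13 * (1 - σ ^ 2) ^ 2 ≤
      (k * nW k (σ ^ 2) * (r + (1 - σ ^ 2) ^ 2 * (7 + 2 * σ ^ 2) / 20)
      + 3 / 2 * (1 - σ ^ 2) ^ 2 * nTp k (σ ^ 2)) / nT k σ ^ 2 := by
  have hb := base_bound hk hk3 (sq_nonneg σ) ((sq_lt_one_iff_abs_lt_one σ).2 h).le hr hr0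
  have h1 := nT_ge hk σ
  have h2 := nT_sq_le hk hk3 σ
  rw [le_div_iff₀ (by positivity)]
  have h3 : 0 ≤ (3 - k) * (1 - σ ^ 2) ^ 2 := mul_nonneg (by linarith) (sq_nonneg _)
  nlinarith [mul_le_mul_of_nonneg_left h2 h3]

lemma nW_abs {k u : ℝ} (hk : 5 / 2 ≤ k) (hk3 : k < 3) (h0 : 0 ≤ u) (h1 : u ≤ 1) :
    |nW k u| ≤ 4 := by
  unfold nW
  have e1 : 0 ≤ (4 * k / 5 - 1) * u := mul_nonneg (by linarith) h0
  have e2 : (4 * k / 5 - 1) * u ≤ (4 * k / 5 - 1) * 1 := mul_le_mul_of_nonneg_left h1 (by linarith)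
  have e3 : 0 ≤ 3 * (2 * k / 5) * u ^ 2 := by positivity
  have e4 : 3 * (2 * k / 5) * u ^ 2 ≤ 3 * (2 * k / 5) * 1 :=
    mul_le_mul_of_nonneg_left (by nlinarith) (by linarith)
  rw [abs_le]; constructor <;> linarith

lemma nXi_abs {k : ℝ} (hk : 5 / 2 ≤ k) (hk3 : k < 3) {σ : ℝ} (h : |σ| ≤ 1) : |nXi k σ| ≤ 3 := by
  have := nT_ge hk σ
  unfold nXi
  rw [abs_div, abs_of_pos (show 0 < nT k σ by linarith), div_le_iff₀ (by linarith), abs_mul,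
    abs_of_pos (show 0 < k by linarith)]
  have := abs_nonneg σ
  nlinarith

lemma gap_abs {k : ℝ} (hk : 5 / 2 ≤ k) (hk3 : k < 3) {σ : ℝ} (h : |σ| ≤ 1) :
    |k * σ - nXi k σ| ≤ 3 := by
  have := nT_ge hk σ
  have e : k * σ - nXi k σ = k * σ * ((nT k σ - 1) / nT k σ) := by
    unfold nXi; field_simp
  have h1 : |(nT k σ - 1) / nT k σ| ≤ 1 := by
    rw [abs_of_nonneg (div_nonneg (by linarith) (by linarith)), div_le_one (by linarith)]; linarith
  rw [e, abs_mul, abs_mul, abs_of_pos (show 0 < k by linarith)]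
  have := abs_nonneg σ
  have := abs_nonneg ((nT k σ - 1) / nT k σ)
  calc k * |σ| * _ ≤ 3 * 1 * 1 := by gcongr
    _ = 3 := by norm_num

lemma gap_sq {k : ℝ} (hk : 5 / 2 ≤ k) (σ : ℝ) : 0 ≤ (k * σ - nXi k σ) * σ := by
  have := nT_ge hk σ
  have e : (k * σ - nXi k σ) * σ = k * σ ^ 2 * ((nT k σ - 1) / nT k σ) := by
    unfold nXi; field_simp
  rw [e]
  have : 0 ≤ (nT k σ - 1) / nT k σ := div_nonneg (by linarith) (by linarith)
  positivity

/-- derivative of `nH` -/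
def nHd (k σ : ℝ) : ℝ := 3 * ((3 - k) / 10000) * (nW k (σ ^ 2) / nT k σ ^ 2 *
    (nChi σ ^ (3 - k) * nQ k σ) + σ / nT k σ * (-(σ * nM σ * nPhi σ) * (3 - k) * nChi σ ^ (3 - k - 1) *
      nQ k σ + nChi σ ^ (3 - k) * -(nOm k σ * (k * σ - nXi k σ))))

lemma nH_deriv {k : ℝ} (hk : 5 / 2 ≤ k) {σ : ℝ} (h : |σ| < 1) :
    HasDerivAt (nH k) (nHd k σ) σ := by
  have hT : nT k σ ≠ 0 := by have := nT_ge hk σ; linarith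
  have h1 := (nChi_deriv h).rpow_const (p := 3 - k) (Or.inl (nChi_pos h).ne')
  have h2 := ((hasDerivAt_id σ).div (nT_deriv k h) hT)
  have h3 := (h2.const_mul (3 * ((3 - k) / 10000))).mul (h1.mul (nQ_deriv hk σ))
  refine h3.congr_deriv ?_
  have e : (1 * nT k σ - id σ * ((4 * k / 5 - 1) * (2 * σ) + 2 * k / 5 * (2 * (1 - nS σ) * (2 * σ)))) =
      nW k (σ ^ 2) := by
    rw [nT_eq k h.le, nS_eq h.le]; simp only [nTp, nW, id]; ring
  unfold nHd
  simp only [Pi.div_apply, Pi.mul_apply]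
  rw [e]
  simp only [id]
  ring

lemma nH_abs {k : ℝ} (hk : 5 / 2 ≤ k) (hk3 : k < 3) {σ : ℝ} (h : |σ| < 1) :
    |nH k σ| ≤ 9 * nE k σ := by
  have hT := nT_ge hk σ
  have hc := nChi_pos h
  have hq := nQ_nonneg hk hk3 h.le
  have hq2 := nQ_le hk hk3 h.le
  have hp : nChi σ ^ (3 - k) * nChi σ ^ k = nChi σ ^ 3 := by
    rw [← Real.rpow_add hc]; norm_num
  have hpos := Real.rpow_pos_of_pos hc (3 - k)
  have h1 : nChi σ ^ (3 - k) * nQ k σ ≤ 3 * nChi σ ^ 3 := by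
    rw [← hp]; unfold nX at hq2; nlinarith
  have h2 : |σ / nT k σ| ≤ 1 := by
    rw [abs_div, abs_of_pos (show 0 < nT k σ by linarith), div_le_one (by linarith)]; linarith
  unfold nH nE
  rw [abs_mul, abs_mul, abs_of_nonneg (show 0 ≤ 3 * ((3 - k) / 10000) by linarith),
    abs_of_nonneg (mul_nonneg hpos.le hq)]
  have h3 : 0 ≤ 3 - k := by linarith
  calc _ ≤ 3 * ((3 - k) / 10000) * 1 * (3 * nChi σ ^ 3) := by gcongr
    _ = _ := by ring

lemma nHd_abs {k : ℝ} (hk : 5 / 2 ≤ k) (hk3 : k < 3) {σ : ℝ} (h : |σ| < 1) :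
    |nHd k σ| ≤ (3 - k) / 10000 * (150 * (1 - σ ^ 2) ^ 2) := by
  have hT := nT_ge hk σ
  have hc := nChi_pos h
  have hc1 := nChi_le_one σ
  have hcS : nChi σ ≤ 1 - σ ^ 2 := by rw [← nS_eq h.le]; exact nChi_le σ
  have hq := nQ_nonneg hk hk3 h.le
  have hq2 : nQ k σ ≤ 3 * nChi σ ^ k := nQ_le hk hk3 h.le
  have hp : nChi σ ^ (3 - k) * nChi σ ^ k = nChi σ ^ 3 := by
    rw [← Real.rpow_add hc]; norm_num
  have hp2 : nChi σ ^ (3 - k - 1) * nChi σ ^ k = nChi σ ^ 2 := by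
    rw [← Real.rpow_add hc, show 3 - k - 1 + k = ((2 : ℕ) : ℝ) by push_cast; ring, Real.rpow_natCast]
  have hp3 : nChi σ ^ (3 - k) * nChi σ ^ (k - 1) = nChi σ ^ 2 := by
    rw [← Real.rpow_add hc]; norm_num
  have p1 := Real.rpow_pos_of_pos hc (3 - k)
  have p2 := Real.rpow_pos_of_pos hc (3 - k - 1)
  have p3 := Real.rpow_pos_of_pos hc (k - 1)
  have h32 : nChi σ ^ 3 ≤ nChi σ ^ 2 := pow_le_pow_of_le_one hc.le hc1 (by norm_num)
  have hσ := h.le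
  have hσ2 : σ ^ 2 ≤ 1 := ((sq_lt_one_iff_abs_lt_one σ).2 h).le
  -- the three terms
  have t1 : |nW k (σ ^ 2) / nT k σ ^ 2 * (nChi σ ^ (3 - k) * nQ k σ)| ≤ 12 * nChi σ ^ 2 := by
    have a1 : |nW k (σ ^ 2) / nT k σ ^ 2| ≤ 4 := by
      rw [abs_div, abs_of_pos (show 0 < nT k σ ^ 2 by positivity), div_le_iff₀ (by positivity)]
      have := nW_abs hk hk3 (sq_nonneg σ) hσ2
      nlinarith
    have a2 : nChi σ ^ (3 - k) * nQ k σ ≤ 3 * nChi σ ^ 3 := by rw [← hp]; nlinarith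
    rw [abs_mul, abs_of_nonneg (mul_nonneg p1.le hq)]
    calc _ ≤ 4 * (3 * nChi σ ^ 3) := by gcongr
      _ ≤ _ := by linarith
  have h2 : |σ / nT k σ| ≤ 1 := by
    rw [abs_div, abs_of_pos (show 0 < nT k σ by linarith), div_le_one (by linarith)]; linarith
  have t2 : |-(σ * nM σ * nPhi σ) * (3 - k) * nChi σ ^ (3 - k - 1) * nQ k σ| ≤ 3 * nChi σ ^ 2 := by
    have a2 : nChi σ ^ (3 - k - 1) * nQ k σ ≤ 3 * nChi σ ^ 2 := by rw [← hp2]; nlinarith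
    have m1 := nM_pos σ
    have m2 := nM_le σ
    have f1 := nPhi_pos σ
    have f2 := nPhi_le σ
    rw [mul_assoc, abs_mul, abs_mul, abs_neg, abs_mul, abs_mul, abs_of_pos m1, abs_of_pos f1,
      abs_of_nonneg (show 0 ≤ 3 - k by linarith), abs_of_nonneg (mul_nonneg p2.le hq)]
    calc _ ≤ 1 * 2 * 1 * (1 / 2) * (3 * nChi σ ^ 2) := by
          gcongr
          linarith
      _ = _ := by ring
  have t3 : |nChi σ ^ (3 - k) * -(nOm k σ * (k * σ - nXi k σ))| ≤ 24 * nChi σ ^ 2 := by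
    have o1 := nOm_nonneg hk σ
    have o2 := nOm_le hk hk3 σ
    have g := gap_abs hk hk3 h.le
    rw [abs_mul, abs_neg, abs_mul, abs_of_pos p1, abs_of_nonneg o1, ← hp3]
    calc _ ≤ nChi σ ^ (3 - k) * ((8 * nChi σ ^ (k - 1)) * 3) := by gcongr
      _ = _ := by ring
  have hcc : nChi σ ^ 2 ≤ (1 - σ ^ 2) ^ 2 := by gcongr
  unfold nHd
  rw [abs_mul, abs_of_nonneg (show 0 ≤ 3 * ((3 - k) / 10000) by linarith)]
  have h3 : 0 ≤ 3 - k := by linarith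
  calc _ ≤ 3 * ((3 - k) / 10000) * (12 * nChi σ ^ 2 + 1 * (3 * nChi σ ^ 2 + 24 * nChi σ ^ 2)) := by
        gcongr
        refine (abs_add_le _ _).trans (add_le_add t1 ?_)
        rw [abs_mul]
        gcongr
        exact (abs_add_le _ _).trans (add_le_add t2 t3)
    _ = (3 - k) / 10000 * (117 * nChi σ ^ 2) := by ring
    _ ≤ _ := by gcongr <;> linarith

lemma nTh_deriv {k : ℝ} (hk : 5 / 2 ≤ k) (hk3 : k < 3) (Z : ℝ) {r σ : ℝ} (hr : -(3 / 5) ≤ r)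
    (h : |σ| < 1) :
    ∃ D, HasDerivAt (nTh k Z r) D σ ∧ (3 - k) / 20 * (1 - σ ^ 2) ^ 2 ≤ D := by
  have hb := nBase_deriv hk Z r h
  have hs : 0 ≤ (1 - σ ^ 2) ^ 2 := sq_nonneg _
  have hk0 : 0 < 3 - k := by linarith
  rcases le_or_gt r 0 with hr0 | hr0
  · refine ⟨_, ?_, le_trans ?_ (nBase_deriv_ge hk hk3 h hr hr0)⟩
    · have e : nTh k Z r = fun σ => Z - nZs σ + nXi k σ * (r + nY σ) := by
        ext σ; simp [nTh, gJ_of_nonpos hr0, ge_of_nonpos hr0]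
      rw [e]; exact hb
    · gcongr; norm_num
  · have e : nTh k Z r = fun σ => Z - nZs σ + nXi k σ * (r + nY σ) +
        (k * σ - nXi k σ) * (r * Real.exp (-(nE k σ / r))) - nH k σ * Real.exp (-(nE k σ / r)) := by
      ext σ; simp [nTh, gJ, ge_of_pos hr0]
    rw [e]
    have hE := ((nE_deriv k h).div_const r).fun_neg.exp
    have hg := ((hasDerivAt_id σ).const_mul k).sub (nXi_deriv hk h)
    refine ⟨_, (hb.add (hg.mul (hE.const_mul r))).sub ((nH_deriv hk h).mul hE), ?_⟩
    have hbase := nBase_deriv_ge hk hk3 h (r := 0) (by norm_num) le_rfl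
    have hT := nT_ge hk σ
    have hEp := nE_pos hk3 h
    set ee := Real.exp (-(nE k σ / r)) with hee
    have ee0 : 0 < ee := Real.exp_pos _
    have ee1 : 1 - nE k σ / r ≤ ee := by
      have := Real.add_one_le_exp (-(nE k σ / r)); linarith
    have ee1' : ee ≤ 1 := Real.exp_le_one_iff.2 (by have : 0 ≤ nE k σ / r := by positivity
                                                    linarith)
    have ee2 : ee * nE k σ ≤ r := by
      have := Real.add_one_le_exp (nE k σ / r)
      rw [hee, Real.exp_neg, inv_mul_le_iff₀ (Real.exp_pos _)]
      have h4 : nE k σ / r ≤ Real.exp (nE k σ / r) := by linarith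
      rwa [div_le_iff₀ hr0] at h4
    have hcS : nChi σ ≤ 1 - σ ^ 2 := by rw [← nS_eq h.le]; exact nChi_le σ
    have hc := nChi_pos h
    have hc1 := nChi_le_one σ
    have hcc : nChi σ ^ 2 ≤ (1 - σ ^ 2) ^ 2 := by gcongr
    have h32 : nChi σ ^ 3 ≤ nChi σ ^ 2 := pow_le_pow_of_le_one hc.le hc1 (by norm_num)
    set X1 := k * nW k (σ ^ 2) / nT k σ ^ 2 with hX1
    have hX1a : |X1| ≤ 12 := by
      rw [hX1, abs_div, abs_of_pos (show 0 < nT k σ ^ 2 by positivity), div_le_iff₀ (by positivity),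
        abs_mul, abs_of_pos (show 0 < k by linarith)]
      have h5 := nW_abs hk hk3 (sq_nonneg σ) ((sq_lt_one_iff_abs_lt_one σ).2 h).le
      have h6 : k * |nW k (σ ^ 2)| ≤ 3 * 4 := by gcongr
      nlinarith
    -- term A
    have tA : -(12 * nE k σ) ≤ X1 * (r * (1 - ee)) := by
      have a0 : 0 ≤ r * (1 - ee) := mul_nonneg hr0.le (by linarith)
      have a1 : r * (1 - ee) ≤ nE k σ := by
        have : r * (1 - ee) ≤ r * (nE k σ / r) := by gcongr; linarith
        rwa [mul_div_cancel₀ _ hr0.ne'] at this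
      have := abs_le.1 hX1a
      nlinarith
    -- term B: derivative of E times gap
    have tB : 0 ≤ (k * σ - nXi k σ) * (3 * ((3 - k) / 10000) * nChi σ ^ 2 * (σ * nM σ * nPhi σ)) * ee := by
      have b1 := gap_sq hk σ
      have b2 := nM_pos σ
      have b3 := nPhi_pos σ
      have : (k * σ - nXi k σ) * (3 * ((3 - k) / 10000) * nChi σ ^ 2 * (σ * nM σ * nPhi σ)) * ee =
        ((k * σ - nXi k σ) * σ) * (3 * ((3 - k) / 10000) * nChi σ ^ 2 * (nM σ * nPhi σ)) * ee := by ring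
      rw [this]; positivity
    -- term C
    have tC : |nH k σ * (ee * ((3 * ((3 - k) / 10000) * nChi σ ^ 2 * (σ * nM σ * nPhi σ)) / r))| ≤
        (3 - k) / 10000 * (54 * (1 - σ ^ 2) ^ 2) := by
      have b2 := nM_pos σ
      have b2' := nM_le σ
      have b3 := nPhi_pos σ
      have b3' := nPhi_le σ
      have hH := nH_abs hk hk3 h
      have c1 : |3 * ((3 - k) / 10000) * nChi σ ^ 2 * (σ * nM σ * nPhi σ)| ≤
          (3 - k) / 10000 * (6 * nChi σ ^ 2) := by
        rw [abs_mul, abs_of_nonneg (show 0 ≤ 3 * ((3 - k) / 10000) * nChi σ ^ 2 by positivity),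
          abs_mul, abs_mul, abs_of_pos b2, abs_of_pos b3]
        calc _ ≤ 3 * ((3 - k) / 10000) * nChi σ ^ 2 * (1 * 2 * 1) := by gcongr
          _ = _ := by ring
      rw [abs_mul, abs_mul, abs_div, abs_of_pos ee0, abs_of_pos hr0]
      calc _ ≤ (9 * nE k σ) * (ee * (((3 - k) / 10000 * (6 * nChi σ ^ 2)) / r)) := by gcongr
        _ = (ee * nE k σ) * (9 * ((3 - k) / 10000 * (6 * nChi σ ^ 2))) / r := by ring
        _ ≤ r * (9 * ((3 - k) / 10000 * (6 * nChi σ ^ 2))) / r := by gcongr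
        _ = (3 - k) / 10000 * (54 * nChi σ ^ 2) := by field_simp; ring
        _ ≤ _ := by gcongr
    have tD : |nHd k σ * ee| ≤ (3 - k) / 10000 * (150 * (1 - σ ^ 2) ^ 2) := by
      rw [abs_mul, abs_of_pos ee0]
      have := nHd_abs hk hk3 h
      have := abs_nonneg (nHd k σ)
      nlinarith
    have tE : 12 * nE k σ ≤ (3 - k) / 10000 * (12 * (1 - σ ^ 2) ^ 2) := by
      unfold nE
      have : (3 - k) / 10000 * nChi σ ^ 3 ≤ (3 - k) / 10000 * (1 - σ ^ 2) ^ 2 := by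
        gcongr; linarith
      linarith
    have hfin : (3 - k) / 20 * (1 - σ ^ 2) ^ 2 ≤ (3 - k) / 13 * (1 - σ ^ 2) ^ 2
        - (3 - k) / 10000 * (216 * (1 - σ ^ 2) ^ 2) := by
      have : 0 ≤ (3 - k) * (1 - σ ^ 2) ^ 2 := by positivity
      linarith
    have tC' := abs_le.1 tC
    have tD' := abs_le.1 tD
    have hk' : 0 ≤ k * r * ee := by positivity
    have hlin : (k * nW k (σ ^ 2) * (r + (1 - σ ^ 2) ^ 2 * (7 + 2 * σ ^ 2) / 20)
      + 3 / 2 * (1 - σ ^ 2) ^ 2 * nTp k (σ ^ 2)) / nT k σ ^ 2 = X1 * r +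
      (k * nW k (σ ^ 2) * (0 + (1 - σ ^ 2) ^ 2 * (7 + 2 * σ ^ 2) / 20)
      + 3 / 2 * (1 - σ ^ 2) ^ 2 * nTp k (σ ^ 2)) / nT k σ ^ 2 := by
      rw [hX1]; ring
    rw [hlin]
    set BB := (k * nW k (σ ^ 2) * (0 + (1 - σ ^ 2) ^ 2 * (7 + 2 * σ ^ 2) / 20)
      + 3 / 2 * (1 - σ ^ 2) ^ 2 * nTp k (σ ^ 2)) / nT k σ ^ 2 with hBB
    have goal_eq : ∀ e' : ℝ, X1 * r + BB + ((k * 1 - X1) * (r * ee) +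
        (k * id σ - nXi k σ) * (r * (ee * -(-(3 * ((3 - k) / 10000) * nChi σ ^ 2 * (σ * nM σ * nPhi σ)) / r))))
        - (nHd k σ * ee + nH k σ * (ee * -(-(3 * ((3 - k) / 10000) * nChi σ ^ 2 * (σ * nM σ * nPhi σ)) / r)))
        = BB + X1 * (r * (1 - ee)) + k * r * ee +
        (k * σ - nXi k σ) * (3 * ((3 - k) / 10000) * nChi σ ^ 2 * (σ * nM σ * nPhi σ)) * ee
        - nHd k σ * ee - nH k σ * (ee * ((3 * ((3 - k) / 10000) * nChi σ ^ 2 * (σ * nM σ * nPhi σ)) / r)) := by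
      intro _
      have hrn : r ≠ 0 := hr0.ne'
      simp only [id]
      field_simp
      ring
    refine le_trans ?_ (goal_eq 0).symm.le
    linarith

lemma ge_cont_E (r : ℝ) : Continuous (ge r) := by
  unfold ge
  split_ifs
  · exact continuous_const
  · fun_prop

lemma nH_cont {k : ℝ} (hk : 5 / 2 ≤ k) (hk3 : k < 3) : Continuous (nH k) := by
  unfold nH
  have h1 : Continuous (fun σ => nChi σ ^ (3 - k)) :=
    nChi_cont.rpow_const (fun x => Or.inr (by linarith))
  have h2 : Continuous (fun σ => σ / nT k σ) :=
    continuous_id.div (nT_cont k) (fun x => by have := nT_ge hk x; linarith)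
  exact (continuous_const.mul h2).mul (h1.mul (nQ_cont hk))

lemma nTh_cont {k : ℝ} (hk : 5 / 2 ≤ k) (hk3 : k < 3) (Z r : ℝ) : Continuous (nTh k Z r) := by
  unfold nTh gJ
  have h1 := nH_cont hk hk3
  have h2 : Continuous (fun σ => ge r (nE k σ)) := (ge_cont_E r).comp (nE_cont k)
  have h3 := nXi_cont hk
  have h4 := nZs_cont
  have h5 := nY_cont
  fun_prop

lemma nF_cont {k : ℝ} (hk : 5 / 2 ≤ k) (Z r : ℝ) : Continuous (nF k Z r) := by
  unfold nF gJ
  have h2 : Continuous (fun σ => ge r (nE k σ)) := (ge_cont_E r).comp (nE_cont k)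
  have h3 := nZ_cont hk
  have h4 := nX_cont hk
  have h5 := nD_cont hk
  have h6 := nQ_cont hk
  fun_prop

def nP (σ : ℝ) : ℝ := σ - 2 * σ ^ 3 / 3 + σ ^ 5 / 5

lemma nP_deriv (σ : ℝ) : HasDerivAt nP ((1 - σ ^ 2) ^ 2) σ := by
  have := ((hasDerivAt_id σ).sub (((hasDerivAt_pow 3 σ).const_mul 2).div_const 3)).add
    ((hasDerivAt_pow 5 σ).div_const 5)
  refine this.congr_deriv ?_
  norm_num; ring

lemma nP_cont : Continuous nP := by unfold nP; fun_prop

lemma abs_lt_of_Ioo {a b τ : ℝ} (ha : -1 ≤ a) (hb : b ≤ 1) (h : τ ∈ Ioo a b) : |τ| < 1 :=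
  abs_lt.2 ⟨by linarith [h.1], by linarith [h.2]⟩

lemma nP_ge {a b : ℝ} (hab : a ≤ b) : nP b - nP a ≥ (4 / 9) * (b - a) * (1 - ((a + b) / 2) ^ 2) ^ 2 := by
  have e : nP b - nP a - (4 / 9) * (b - a) * (1 - ((a + b) / 2) ^ 2) ^ 2 =
    (b - a) * ((1 / 5) * (((b - a) / 2) ^ 2 - (5 / 3) * (1 - ((a + b) / 2) ^ 2)) ^ 2 +
      (4 / 3) * ((a + b) / 2) ^ 2 * ((b - a) / 2) ^ 2) := by
    unfold nP; ring
  have : 0 ≤ b - a := by linarith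
  have : 0 ≤ nP b - nP a - (4 / 9) * (b - a) * (1 - ((a + b) / 2) ^ 2) ^ 2 := by
    rw [e]; positivity
  linarith

lemma mid_lt {a b : ℝ} (ha : -1 ≤ a) (hb : b ≤ 1) (hab : a < b) : 0 < 1 - ((a + b) / 2) ^ 2 := by
  have h1 : 0 < 1 - (a + b) / 2 := by linarith
  have h2 : 0 < 1 + (a + b) / 2 := by linarith
  nlinarith [mul_pos h1 h2]

lemma nP_strict {a b : ℝ} (ha : -1 ≤ a) (hb : b ≤ 1) (hab : a < b) : nP a < nP b := by
  have h1 := nP_ge hab.le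
  have h2 := mid_lt ha hb hab
  have h3 : 0 < b - a := by linarith
  have : 0 < (4 / 9) * (b - a) * (1 - ((a + b) / 2) ^ 2) ^ 2 := by positivity
  linarith

lemma nTh_mono {k : ℝ} (hk : 5 / 2 ≤ k) (hk3 : k < 3) (Z : ℝ) {r : ℝ} (hr : -(3 / 5) ≤ r)
    {a b : ℝ} (ha : -1 ≤ a) (hb : b ≤ 1) (hab : a ≤ b) :
    (3 - k) / 20 * (nP b - nP a) ≤ nTh k Z r b - nTh k Z r a := by
  have hm : MonotoneOn (fun τ => nTh k Z r τ - (3 - k) / 20 * nP τ) (Icc a b) := by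
    have hd : ∀ τ ∈ Ioo a b, ∃ D, HasDerivAt (fun τ => nTh k Z r τ - (3 - k) / 20 * nP τ) D τ ∧ 0 ≤ D := by
      intro τ hτ
      obtain ⟨D, h1, h2⟩ := nTh_deriv hk hk3 Z hr (abs_lt_of_Ioo ha hb hτ)
      exact ⟨_, h1.sub ((nP_deriv τ).const_mul _), by linarith⟩
    apply monotoneOn_of_deriv_nonneg (convex_Icc a b)
    · exact ((nTh_cont hk hk3 Z r).sub (continuous_const.mul nP_cont)).continuousOn
    · rw [interior_Icc]
      intro τ hτ
      obtain ⟨D, h1, h2⟩ := hd τ hτ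
      exact h1.differentiableAt.differentiableWithinAt
    · rw [interior_Icc]
      intro τ hτ
      obtain ⟨D, h1, h2⟩ := hd τ hτ
      rw [h1.deriv]; exact h2
  have := hm (left_mem_Icc.2 hab) (right_mem_Icc.2 hab) hab
  simp only at this
  linarith

lemma nTh_strict {k : ℝ} (hk : 5 / 2 ≤ k) (hk3 : k < 3) (Z : ℝ) {r : ℝ} (hr : -(3 / 5) ≤ r)
    {a b : ℝ} (ha : -1 ≤ a) (hb : b ≤ 1) (hab : a < b) : nTh k Z r a < nTh k Z r b := by
  have h1 := nTh_mono hk hk3 Z hr ha hb hab.le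
  have h2 := nP_strict ha hb hab
  have : 0 < (3 - k) / 20 * (nP b - nP a) := mul_pos (by linarith) (by linarith)
  linarith

def IsSg (k Z r σ : ℝ) : Prop :=
  -1 ≤ σ ∧ σ ≤ 1 ∧ (σ < 1 → 0 ≤ nTh k Z r σ) ∧ (-1 < σ → nTh k Z r σ ≤ 0)

lemma IsSg_exists {k : ℝ} (hk : 5 / 2 ≤ k) (hk3 : k < 3) (Z r : ℝ) : ∃ σ, IsSg k Z r σ := by
  rcases le_or_gt (nTh k Z r 1) 0 with h | h
  · exact ⟨1, by norm_num, le_rfl, fun h => absurd h (lt_irrefl _), fun _ => h⟩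
  rcases le_or_gt 0 (nTh k Z r (-1)) with h' | h'
  · exact ⟨-1, le_rfl, by norm_num, fun _ => h', fun h => absurd h (lt_irrefl _)⟩
  have := intermediate_value_Icc (show (-1 : ℝ) ≤ 1 by norm_num) (nTh_cont hk hk3 Z r).continuousOn
  obtain ⟨σ, hσ, h0⟩ := this ⟨h'.le, h.le⟩
  exact ⟨σ, hσ.1, hσ.2, fun _ => h0.ge, fun _ => h0.le⟩

lemma IsSg_unique {k : ℝ} (hk : 5 / 2 ≤ k) (hk3 : k < 3) {Z r : ℝ} (hr : -(3 / 5) ≤ r) {σ τ : ℝ}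
    (h : IsSg k Z r σ) (h' : IsSg k Z r τ) : σ = τ := by
  have aux : ∀ {a b}, IsSg k Z r a → IsSg k Z r b → ¬ a < b := by
    intro a b ha hb hab
    have h1 := nTh_strict hk hk3 Z hr ha.1 hb.2.1 hab
    have h2 := ha.2.2.1 (by linarith [hb.2.1])
    have h3 := hb.2.2.2 (by linarith [ha.1])
    linarith
  rcases lt_trichotomy σ τ with h1 | h1 | h1
  · exact absurd h1 (aux h h')
  · exact h1
  · exact absurd h1 (aux h' h)

lemma IsSg_max {k : ℝ} (hk : 5 / 2 ≤ k) (hk3 : k < 3) {Z r : ℝ} (hr : -(3 / 5) ≤ r) {σ : ℝ}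
    (h : IsSg k Z r σ) {τ : ℝ} (h1 : -1 ≤ τ) (h2 : τ ≤ 1) : nF k Z r τ ≤ nF k Z r σ := by
  rcases lt_trichotomy τ σ with hl | he | hl
  · have hm : MonotoneOn (nF k Z r) (Icc τ σ) := by
      apply monotoneOn_of_deriv_nonneg (convex_Icc _ _) (nF_cont hk Z r).continuousOn
      · rw [interior_Icc]; intro t ht
        exact (nF_deriv hk Z r (abs_lt_of_Ioo h1 h.2.1 ht)).differentiableAt.differentiableWithinAt
      · rw [interior_Icc]; intro t ht
        rw [(nF_deriv hk Z r (abs_lt_of_Ioo h1 h.2.1 ht)).deriv]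
        have h3 := nTh_strict hk hk3 Z hr (by linarith [ht.1]) h.2.1 ht.2
        have h4 := h.2.2.2 (by linarith)
        have h5 := nOm_nonneg hk t
        nlinarith
    exact hm (left_mem_Icc.2 hl.le) (right_mem_Icc.2 hl.le) hl.le
  · rw [he]
  · have hm : AntitoneOn (nF k Z r) (Icc σ τ) := by
      apply antitoneOn_of_deriv_nonpos (convex_Icc _ _) (nF_cont hk Z r).continuousOn
      · rw [interior_Icc]; intro t ht
        exact (nF_deriv hk Z r (abs_lt_of_Ioo h.1 h2 ht)).differentiableAt.differentiableWithinAt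
      · rw [interior_Icc]; intro t ht
        rw [(nF_deriv hk Z r (abs_lt_of_Ioo h.1 h2 ht)).deriv]
        have h3 := nTh_strict hk hk3 Z hr h.1 (by linarith [ht.2]) ht.1
        have h4 := h.2.2.1 (by linarith)
        have h5 := nOm_nonneg hk t
        nlinarith
    exact hm (left_mem_Icc.2 hl.le) (right_mem_Icc.2 hl.le) hl.le

lemma chi_mid {a b σ : ℝ} (ha : -1 ≤ a) (hb : b ≤ 1) (h1 : a ≤ σ) (h2 : σ ≤ b) :
    nChi σ ≤ 3 * (1 - ((a + b) / 2) ^ 2) := by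
  have hσ : |σ| ≤ 1 := abs_le.2 ⟨by linarith, by linarith⟩
  refine (nChi_le σ).trans ?_
  rw [nS_eq hσ]
  rcases le_total 0 ((a + b) / 2) with h | h
  · nlinarith
  · nlinarith

lemma len_mid {a b : ℝ} (ha : -1 ≤ a) (hb : b ≤ 1) (hab : a ≤ b) :
    b - a ≤ 2 * (1 - ((a + b) / 2) ^ 2) := by
  rcases le_total 0 ((a + b) / 2) with h | h
  · nlinarith
  · nlinarith

lemma osc {k : ℝ} (hk : 5 / 2 ≤ k) (hk3 : k < 3) {f : ℝ → ℝ} {C : ℝ} (hC : 0 ≤ C) (hf : Continuous f)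
    (hd : ∀ σ, |σ| < 1 → ∃ D, HasDerivAt f D σ ∧ |D| ≤ C * nChi σ ^ (k - 1))
    {a b : ℝ} (ha : -1 ≤ a) (hb : b ≤ 1) (hab : a ≤ b) :
    |f b - f a| ≤ 60 * C * (nP b - nP a) ^ (k / 3) := by
  rcases hab.eq_or_lt with rfl | hlt
  · simp only [sub_self, abs_zero]
    rw [Real.zero_rpow (by linarith)]; simp
  set A := 1 - ((a + b) / 2) ^ 2 with hA
  have hA0 : 0 < A := mid_lt ha hb hlt
  have hA1 : A ≤ 1 := by rw [hA]; nlinarith [sq_nonneg ((a + b) / 2)]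
  obtain ⟨ξ, hξ, he⟩ := exists_deriv_eq_slope f hlt hf.continuousOn (fun x hx => by
    obtain ⟨D, h1, _⟩ := hd x (abs_lt_of_Ioo ha hb hx)
    exact h1.differentiableAt.differentiableWithinAt)
  obtain ⟨D, h1, h2⟩ := hd ξ (abs_lt_of_Ioo ha hb hξ)
  rw [h1.deriv] at he
  have hba : 0 < b - a := by linarith
  have he' : f b - f a = D * (b - a) := by rw [he]; field_simp
  set t := (b - a) / (2 * A) with ht
  have ht0 : 0 < t := by positivity
  have ht1 : t ≤ 1 := by rw [ht, div_le_one (by positivity)]; exact len_mid ha hb hab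
  have hbt : b - a = 2 * A * t := by rw [ht]; field_simp
  have hchi : nChi ξ ^ (k - 1) ≤ 9 * A ^ (k - 1) := by
    calc nChi ξ ^ (k - 1) ≤ (3 * A) ^ (k - 1) :=
          Real.rpow_le_rpow (nChi_nonneg _) (chi_mid ha hb hξ.1.le hξ.2.le) (by linarith)
      _ = 3 ^ (k - 1) * A ^ (k - 1) := Real.mul_rpow (by norm_num) hA0.le
      _ ≤ 3 ^ (2 : ℝ) * A ^ (k - 1) := by
          gcongr
          · norm_num
          · linarith
      _ = _ := by norm_num
  have hP := nP_ge hab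
  rw [← hA] at hP
  have hP3 : A ^ 3 * t ≤ (9 / 8) * (nP b - nP a) := by
    rw [hbt] at hP
    nlinarith
  have hP0 : 0 ≤ nP b - nP a := by have := nP_strict ha hb hlt; linarith
  have e1 : A ^ (k - 1) * A = A ^ k := by
    rw [← Real.rpow_add_one hA0.ne']; ring_nf
  have e2 : (A ^ 3 * t) ^ (k / 3) = A ^ k * t ^ (k / 3) := by
    rw [Real.mul_rpow (by positivity) ht0.le, ← Real.rpow_natCast, ← Real.rpow_mul hA0.le]
    congr 2; push_cast; ring
  have e3 : t ≤ t ^ (k / 3) := by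
    conv_lhs => rw [← Real.rpow_one t]
    exact Real.rpow_le_rpow_of_exponent_ge ht0 ht1 (by linarith)
  have hAk : 0 < A ^ k := Real.rpow_pos_of_pos hA0 _
  have e4 : A ^ k * t ≤ 2 * (nP b - nP a) ^ (k / 3) := by
    calc A ^ k * t ≤ A ^ k * t ^ (k / 3) := by gcongr
      _ = (A ^ 3 * t) ^ (k / 3) := e2.symm
      _ ≤ ((9 / 8) * (nP b - nP a)) ^ (k / 3) :=
          Real.rpow_le_rpow (by positivity) hP3 (by linarith)
      _ = (9 / 8) ^ (k / 3) * (nP b - nP a) ^ (k / 3) := Real.mul_rpow (by norm_num) hP0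
      _ ≤ (9 / 8) ^ (1 : ℝ) * (nP b - nP a) ^ (k / 3) := by
          gcongr
          · norm_num
          · linarith
      _ ≤ _ := by
          rw [Real.rpow_one]; gcongr; norm_num
  have hr0 : 0 ≤ (nP b - nP a) ^ (k / 3) := Real.rpow_nonneg hP0 _
  rw [he', abs_mul, abs_of_pos hba]
  calc |D| * (b - a) ≤ (C * (9 * A ^ (k - 1))) * (2 * A * t) := by
        rw [← hbt]; gcongr; exact h2.trans (by gcongr)
    _ = 18 * C * ((A ^ (k - 1) * A) * t) := by ring
    _ ≤ 18 * C * (2 * (nP b - nP a) ^ (k / 3)) := by rw [e1]; gcongr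
    _ ≤ _ := by nlinarith [mul_nonneg hC hr0]

lemma nH_abs' {k : ℝ} (hk : 5 / 2 ≤ k) (hk3 : k < 3) {σ : ℝ} (h : |σ| ≤ 1) :
    |nH k σ| ≤ 9 * nE k σ := by
  rcases h.lt_or_eq with h | h
  · exact nH_abs hk hk3 h
  · have : nQ k σ = 0 := by
      rcases eq_or_eq_neg_of_abs_eq h with rfl | rfl
      · exact nQ_one k
      · exact nQ_neg_one k
    have h2 := nE_nonneg hk3 σ
    unfold nH; rw [this]; simp; exact h2

lemma nTh_lip {k : ℝ} (hk : 5 / 2 ≤ k) (hk3 : k < 3) (Z Z' r r' : ℝ) {σ : ℝ} (h : |σ| ≤ 1) :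
    |nTh k Z r σ - nTh k Z' r' σ| ≤ |Z - Z'| + 24 * |r - r'| := by
  have hE := nE_nonneg hk3 σ
  have e : nTh k Z r σ - nTh k Z' r' σ = (Z - Z') + nXi k σ * (r - r') +
      (k * σ - nXi k σ) * (gJ r (nE k σ) - gJ r' (nE k σ)) -
      nH k σ * (ge r (nE k σ) - ge r' (nE k σ)) := by unfold nTh; ring
  rw [e]
  have t1 : |nXi k σ * (r - r')| ≤ 3 * |r - r'| := by
    rw [abs_mul]; gcongr; exact nXi_abs hk hk3 h
  have t2 : |(k * σ - nXi k σ) * (gJ r (nE k σ) - gJ r' (nE k σ))| ≤ 3 * |r - r'| := by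
    rw [abs_mul]
    exact mul_le_mul (gap_abs hk hk3 h) (gJ_lip r r' hE) (abs_nonneg _) (by norm_num)
  have t3 : |nH k σ * (ge r (nE k σ) - ge r' (nE k σ))| ≤ 18 * |r - r'| := by
    rw [abs_mul]
    have h1 := nH_abs' hk hk3 h
    have h2 := ge_lip r r' hE
    calc _ ≤ 9 * nE k σ * |ge r (nE k σ) - ge r' (nE k σ)| := by gcongr
      _ ≤ _ := by nlinarith
  have := abs_sub ((Z - Z') + nXi k σ * (r - r') +
      (k * σ - nXi k σ) * (gJ r (nE k σ) - gJ r' (nE k σ))) (nH k σ * (ge r (nE k σ) - ge r' (nE k σ)))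
  have := abs_add_le ((Z - Z') + nXi k σ * (r - r'))
      ((k * σ - nXi k σ) * (gJ r (nE k σ) - gJ r' (nE k σ)))
  have := abs_add_le (Z - Z') (nXi k σ * (r - r'))
  linarith

lemma sel {k : ℝ} (hk : 5 / 2 ≤ k) (hk3 : k < 3) {Z Z' r r' a b : ℝ} (hr : -(3 / 5) ≤ r)
    (h : IsSg k Z r a) (h' : IsSg k Z' r' b) (hab : a ≤ b) :
    (3 - k) / 20 * (nP b - nP a) ≤ |Z - Z'| + 24 * |r - r'| := by
  rcases hab.eq_or_lt with rfl | hlt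
  · simp; positivity
  have h1 := nTh_mono hk hk3 Z hr h.1 h'.2.1 hab
  have h2 := h.2.2.1 (by linarith [h'.2.1])
  have h3 := h'.2.2.2 (by linarith [h.1])
  have h4 := nTh_lip hk hk3 Z Z' r r' (σ := b) (abs_le.2 ⟨h'.1, h'.2.1⟩)
  have h5 := le_abs_self (nTh k Z r b - nTh k Z' r' b)
  linarith

lemma z_der {k : ℝ} (hk : 5 / 2 ≤ k) (hk3 : k < 3) (σ : ℝ) :
    ∃ D, HasDerivAt (nZ k) D σ ∧ |D| ≤ 8 * nChi σ ^ (k - 1) :=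
  ⟨_, nZ_deriv hk σ, by rw [abs_neg, abs_of_nonneg (nOm_nonneg hk σ)]; exact nOm_le hk hk3 σ⟩

lemma xq_der {k : ℝ} (hk : 5 / 2 ≤ k) (hk3 : k < 3) (r : ℝ) (σ : ℝ) (h : |σ| < 1) :
    ∃ D, HasDerivAt (fun σ => nX k σ + nQ k σ * gJr r (nE k σ)) D σ ∧
      |D| ≤ 90 * nChi σ ^ (k - 1) := by
  have hχ := nChi_pos h
  have hp := Real.rpow_pos_of_pos hχ (k - 1)
  have hom := nOm_le hk hk3 σ
  have hom0 := nOm_nonneg hk σ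
  have t1 : |-(nOm k σ * nXi k σ)| ≤ 24 * nChi σ ^ (k - 1) := by
    rw [abs_neg, abs_mul, abs_of_nonneg hom0]
    have := nXi_abs hk hk3 h.le
    calc _ ≤ 8 * nChi σ ^ (k - 1) * 3 := by gcongr
      _ = _ := by ring
  have t2 : |-(nOm k σ * (k * σ - nXi k σ))| ≤ 24 * nChi σ ^ (k - 1) := by
    rw [abs_neg, abs_mul, abs_of_nonneg hom0]
    have := gap_abs hk hk3 h.le
    calc _ ≤ 8 * nChi σ ^ (k - 1) * 3 := by gcongr
      _ = _ := by ring
  rcases le_or_gt r 0 with hr | hr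
  · refine ⟨_, ?_, t1.trans (by gcongr; norm_num)⟩
    have : (fun σ => nX k σ + nQ k σ * gJr r (nE k σ)) = nX k := by
      ext σ; simp [gJr_of_nonpos hr]
    rw [this]; exact nX_deriv hk σ
  · have e : (fun σ => nX k σ + nQ k σ * gJr r (nE k σ)) =
        fun σ => nX k σ + nQ k σ * (Real.exp (-(nE k σ / r)) * (1 + nE k σ / r)) := by
      ext σ; simp [gJr, ge_of_pos hr]
    rw [e]
    set E' := -(3 * ((3 - k) / 10000) * nChi σ ^ 2 * (σ * nM σ * nPhi σ)) with hE'
    have hE := ((nE_deriv k h).div_const r)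
    have h3 := hE.fun_neg.exp.mul (hE.const_add 1)
    refine ⟨_, (nX_deriv hk σ).add ((nQ_deriv hk σ).mul h3), ?_⟩
    set ee := Real.exp (-(nE k σ / r)) with hee
    have hEp := nE_pos hk3 h
    have hg1 : |ee * (1 + nE k σ / r)| ≤ 1 := by
      have e1 : ee * (1 + nE k σ / r) = gJr r (nE k σ) := by simp [gJr, ge_of_pos hr, hee]
      rw [e1, abs_of_nonneg (gJr_nonneg r hEp.le)]
      exact gJr_le_one r hEp.le
    have hrn : r ≠ 0 := hr.ne'
    have e2 : ee * -(E' / r) * (1 + nE k σ / r) + ee * (E' / r) =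
        -(((nE k σ / r) ^ 2 * ee) * (E' / nE k σ)) := by
      field_simp; ring
    have e3 : E' / nE k σ = -(3 * (σ * nM σ * nPhi σ)) / nChi σ := by
      have : (3 - k) ≠ 0 := by linarith
      rw [hE']; unfold nE; field_simp
    have e4 : |(nE k σ / r) ^ 2 * ee| ≤ 2 := by
      have hy : 0 ≤ nE k σ / r := by positivity
      rw [abs_of_nonneg (by positivity), hee, Real.exp_neg, ← div_eq_mul_inv,
        div_le_iff₀ (Real.exp_pos _)]
      have := Real.quadratic_le_exp_of_nonneg hy
      nlinarith
    have m1 := nM_pos σ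
    have m2 := nM_le σ
    have f1 := nPhi_pos σ
    have f2 := nPhi_le σ
    have e5 : |E' / nE k σ| ≤ 6 / nChi σ := by
      rw [e3, abs_div, abs_of_pos hχ, abs_neg, abs_mul, abs_mul, abs_mul, abs_of_pos m1, abs_of_pos f1]
      gcongr
      calc |(3 : ℝ)| * (|σ| * nM σ * nPhi σ) ≤ 3 * (1 * 2 * 1) := by
            rw [abs_of_pos (by norm_num)]; gcongr
        _ = 6 := by norm_num
    have hq := nQ_nonneg hk hk3 h.le
    have hq2 : nQ k σ ≤ 3 * nChi σ ^ k := nQ_le hk hk3 h.le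
    have e6 : nChi σ ^ k / nChi σ = nChi σ ^ (k - 1) := by
      rw [Real.rpow_sub_one hχ.ne']
    have t3 : |nQ k σ * (ee * -(E' / r) * (1 + nE k σ / r) + ee * (E' / r))| ≤
        36 * nChi σ ^ (k - 1) := by
      rw [e2, abs_mul, abs_neg, abs_mul, abs_of_nonneg hq, ← e6]
      calc _ ≤ 3 * nChi σ ^ k * (2 * (6 / nChi σ)) := by gcongr
        _ = _ := by ring
    have t4 : |-(nOm k σ * (k * σ - nXi k σ)) * (ee * (1 + nE k σ / r))| ≤ 24 * nChi σ ^ (k - 1) := by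
      rw [abs_mul]
      calc _ ≤ (24 * nChi σ ^ (k - 1)) * 1 := by gcongr
        _ = _ := by ring
    refine (abs_add_le _ _).trans ?_
    have := abs_add_le (-(nOm k σ * (k * σ - nXi k σ)) * (ee * (1 + nE k σ / r)))
      (nQ k σ * (ee * -(E' / r) * (1 + nE k σ / r) + ee * (E' / r)))
    refine (add_le_add t1 this).trans ?_
    linarith

lemma gJr_cont_E (r : ℝ) : Continuous (gJr r) := by
  unfold gJr
  have := ge_cont_E r
  fun_prop

lemma xq_cont {k : ℝ} (hk : 5 / 2 ≤ k) (r : ℝ) :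
    Continuous (fun σ => nX k σ + nQ k σ * gJr r (nE k σ)) :=
  (nX_cont hk).add ((nQ_cont hk).mul ((gJr_cont_E r).comp (nE_cont k)))

lemma q_var {k : ℝ} (hk : 5 / 2 ≤ k) (hk3 : k < 3) (r r' : ℝ) {σ : ℝ} (h : |σ| ≤ 1) :
    |nQ k σ * gJr r (nE k σ) - nQ k σ * gJr r' (nE k σ)| ≤
      3 * (60000 / (3 - k)) ^ (k / 3) * |r - r'| ^ (k / 3) := by
  have h3 : 0 < 3 - k := by linarith
  rcases h.lt_or_eq with h | h
  swap
  · have : nQ k σ = 0 := by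
      rcases eq_or_eq_neg_of_abs_eq h with rfl | rfl
      · exact nQ_one k
      · exact nQ_neg_one k
    rw [this]; simp; positivity
  have hχ := nChi_pos h
  have hE := nE_pos hk3 h
  have hq := nQ_nonneg hk hk3 h.le
  have hq2 : nQ k σ ≤ 3 * nChi σ ^ k := nQ_le hk hk3 h.le
  set d := |gJr r (nE k σ) - gJr r' (nE k σ)| with hd
  have d0 : 0 ≤ d := abs_nonneg _
  have d1 : d ≤ 1 := by
    have a1 := gJr_nonneg r hE.le
    have a2 := gJr_nonneg r' hE.le
    have a3 := gJr_le_one r hE.le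
    have a4 := gJr_le_one r' hE.le
    rw [hd, abs_le]; constructor <;> linarith
  have d2 : d ≤ d ^ (k / 3) := by
    rcases d0.eq_or_lt with h0 | h0
    · rw [← h0, Real.zero_rpow (by linarith)]
    · conv_lhs => rw [← Real.rpow_one d]
      exact Real.rpow_le_rpow_of_exponent_ge h0 d1 (by linarith)
  have hl := gJr_lip r r' hE.le
  rw [← hd] at hl
  have key : nChi σ ^ 3 * d ≤ (60000 / (3 - k)) * |r - r'| := by
    unfold nE at hl
    rw [div_mul_eq_mul_div, le_div_iff₀ h3]
    nlinarith
  have e2 : (nChi σ ^ 3 * d) ^ (k / 3) = nChi σ ^ k * d ^ (k / 3) := by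
    rw [Real.mul_rpow (by positivity) d0, ← Real.rpow_natCast, ← Real.rpow_mul hχ.le]
    congr 2; push_cast; ring
  rw [← mul_sub, abs_mul, abs_of_nonneg hq, ← hd]
  have hp := Real.rpow_pos_of_pos hχ k
  calc nQ k σ * d ≤ 3 * nChi σ ^ k * d ^ (k / 3) := by gcongr
    _ = 3 * (nChi σ ^ 3 * d) ^ (k / 3) := by rw [e2]; ring
    _ ≤ 3 * ((60000 / (3 - k)) * |r - r'|) ^ (k / 3) := by gcongr
    _ = _ := by rw [Real.mul_rpow (by positivity) (abs_nonneg _)]; ring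

lemma hoelder {k : ℝ} (hk : 5 / 2 ≤ k) (hk3 : k < 3) : ∃ C, 0 ≤ C ∧ ∀ Z Z' r r' a b : ℝ,
    -(3 / 5) ≤ r → -(3 / 5) ≤ r' → IsSg k Z r a → IsSg k Z' r' b →
    |nP a - nP b| ≤ C * (|Z - Z'| + |r - r'|) ∧
    |nZ k a - nZ k b| ≤ C * (|Z - Z'| + |r - r'|) ^ (k / 3) ∧
    |(nX k a + nQ k a * gJr r (nE k a)) - (nX k b + nQ k b * gJr r' (nE k b))| ≤
      C * (|Z - Z'| + |r - r'|) ^ (k / 3) := by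
  have h3 : 0 < 3 - k := by linarith
  set C1 := 480 / (3 - k) with hC1
  have hC1p : 0 < C1 := by positivity
  set C2 := 5400 * C1 ^ (k / 3) + 3 * (60000 / (3 - k)) ^ (k / 3) with hC2
  have hC2p : 0 ≤ C2 := by positivity
  refine ⟨C1 + C2, by positivity, ?_⟩
  have main : ∀ Z Z' r r' a b : ℝ, a ≤ b → 
    -(3 / 5) ≤ r → -(3 / 5) ≤ r' → IsSg k Z r a → IsSg k Z' r' b →
    |nP a - nP b| ≤ (C1 + C2) * (|Z - Z'| + |r - r'|) ∧
    |nZ k a - nZ k b| ≤ (C1 + C2) * (|Z - Z'| + |r - r'|) ^ (k / 3) ∧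
    |(nX k a + nQ k a * gJr r (nE k a)) - (nX k b + nQ k b * gJr r' (nE k b))| ≤
      (C1 + C2) * (|Z - Z'| + |r - r'|) ^ (k / 3) := by
    intro Z Z' r r' a b hab hr hr' ha hb
    have hs := sel hk hk3 hr ha hb hab
    set D := |Z - Z'| + |r - r'| with hD
    have hD0 : 0 ≤ D := by positivity
    have hrD : |r - r'| ≤ D := by rw [hD]; linarith [abs_nonneg (Z - Z')]
    have hP0 : 0 ≤ nP b - nP a := by
      rcases hab.eq_or_lt with rfl | h
      · simp
      · have := nP_strict ha.1 hb.2.1 h; linarith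
    have hP : nP b - nP a ≤ C1 * D := by
      rw [hC1, div_mul_eq_mul_div, le_div_iff₀ h3]
      have := abs_nonneg (Z - Z')
      rw [hD]; linarith
    have hPr : (nP b - nP a) ^ (k / 3) ≤ C1 ^ (k / 3) * D ^ (k / 3) := by
      rw [← Real.mul_rpow hC1p.le hD0]
      exact Real.rpow_le_rpow hP0 hP (by linarith)
    have hDr : 0 ≤ D ^ (k / 3) := Real.rpow_nonneg hD0 _
    have hCr : 0 ≤ C1 ^ (k / 3) := Real.rpow_nonneg hC1p.le _
    have h60 : 0 ≤ 3 * (60000 / (3 - k)) ^ (k / 3) := by positivity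
    refine ⟨?_, ?_, ?_⟩
    · rw [abs_sub_comm, abs_of_nonneg hP0]
      nlinarith
    · rw [abs_sub_comm]
      have := osc hk hk3 (by norm_num) (nZ_cont hk) (fun σ _ => z_der hk hk3 σ) ha.1 hb.2.1 hab
      refine this.trans ?_
      calc 60 * 8 * (nP b - nP a) ^ (k / 3) ≤ 5400 * (C1 ^ (k / 3) * D ^ (k / 3)) := by
            have : 0 ≤ (nP b - nP a) ^ (k / 3) := Real.rpow_nonneg hP0 _
            linarith
        _ = (5400 * C1 ^ (k / 3)) * D ^ (k / 3) := by ring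
        _ ≤ _ := by gcongr; rw [hC2]; linarith
    · have o := osc hk hk3 (C := 90) (by norm_num) (xq_cont hk r) (fun σ h => xq_der hk hk3 r σ h)
        ha.1 hb.2.1 hab
      have v := q_var hk hk3 r r' (σ := b) (abs_le.2 ⟨hb.1, hb.2.1⟩)
      rw [abs_sub_comm] at o
      have e : (nX k a + nQ k a * gJr r (nE k a)) - (nX k b + nQ k b * gJr r' (nE k b)) =
        ((nX k a + nQ k a * gJr r (nE k a)) - (nX k b + nQ k b * gJr r (nE k b))) +
        (nQ k b * gJr r (nE k b) - nQ k b * gJr r' (nE k b)) := by ring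
      rw [e]
      refine (abs_add_le _ _).trans ?_
      have : |r - r'| ^ (k / 3) ≤ D ^ (k / 3) := Real.rpow_le_rpow (abs_nonneg _) hrD (by linarith)
      calc _ ≤ 60 * 90 * (C1 ^ (k / 3) * D ^ (k / 3)) +
            3 * (60000 / (3 - k)) ^ (k / 3) * D ^ (k / 3) := by
            refine add_le_add (o.trans ?_) (v.trans ?_) <;> gcongr
        _ = C2 * D ^ (k / 3) := by rw [hC2]; ring
        _ ≤ _ := by gcongr; linarith
  intro Z Z' r r' a b hr hr' ha hb
  rcases le_total a b with hab | hab
  · exact main Z Z' r r' a b hab hr hr' ha hb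
  · have := main Z' Z r' r b a hab hr' hr hb ha
    rw [abs_sub_comm Z Z', abs_sub_comm r r', abs_sub_comm (nP a), abs_sub_comm (nZ k a),
      abs_sub_comm (nX k a + _)]
    exact this

abbrev E3 := EuclideanSpace ℝ (Fin 3)

def rho (p : E3) : ℝ := (p 1 ^ 2 + p 2 ^ 2 + p 0 ^ 2 / 5) / 2
def rr (p : E3) : ℝ := rho p - 3 / 5
def drho (p : E3) : E3 := !₂[p 0 / 5, p 1, p 2]
def e0 : E3 := !₂[1, 0, 0]
def sg (k : ℝ) (p : E3) : ℝ := Classical.epsilon (IsSg k (p 0) (rr p))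
def GG (k : ℝ) (p : E3) : ℝ := nF k (p 0) (rr p) (sg k p)
def Bc (k : ℝ) (p : E3) : ℝ := nX k (sg k p) + nQ k (sg k p) * gJr (rr p) (nE k (sg k p))
def Hg (k : ℝ) (p : E3) : E3 := nZ k (sg k p) • e0 + Bc k p • drho p

lemma rho_nonneg (p : E3) : 0 ≤ rho p := by unfold rho; positivity
lemma rr_ge (p : E3) : -(3 / 5) ≤ rr p := by have := rho_nonneg p; unfold rr; linarith

lemma sg_spec {k : ℝ} (hk : 5 / 2 ≤ k) (hk3 : k < 3) (p : E3) : IsSg k (p 0) (rr p) (sg k p) :=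
  Classical.epsilon_spec (IsSg_exists hk hk3 (p 0) (rr p))

lemma sg_abs {k : ℝ} (hk : 5 / 2 ≤ k) (hk3 : k < 3) (p : E3) : |sg k p| ≤ 1 :=
  abs_le.2 ⟨(sg_spec hk hk3 p).1, (sg_spec hk hk3 p).2.1⟩

lemma inner3 (x y : E3) : ⟪x, y⟫ = x 0 * y 0 + x 1 * y 1 + x 2 * y 2 := by
  rw [PiLp.inner_apply, Fin.sum_univ_three]
  simp [mul_comm]

lemma norm3_sq (x : E3) : ‖x‖ ^ 2 = x 0 ^ 2 + x 1 ^ 2 + x 2 ^ 2 := by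
  rw [EuclideanSpace.norm_sq_eq, Fin.sum_univ_three]; simp

lemma Hg_inner (k : ℝ) (p v : E3) : ⟪Hg k p, v⟫ =
    nZ k (sg k p) * v 0 + Bc k p * (p 0 * v 0 / 5 + p 1 * v 1 + p 2 * v 2) := by
  rw [inner3]; simp [Hg, e0, drho]; ring

lemma GG_subgrad {k : ℝ} (hk : 5 / 2 ≤ k) (hk3 : k < 3) (x y : E3) :
    GG k x + ⟪Hg k x, y - x⟫ + nX k (sg k x) * rho (y - x) ≤ GG k y := by
  have hs := sg_spec hk hk3 x
  refine le_trans ?_ (IsSg_max hk hk3 (rr_ge y) (sg_spec hk hk3 y) hs.1 hs.2.1)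
  have hE := nE_nonneg hk3 (sg k x)
  have h1 := gJ_subgrad (rr x) (rr y) hE
  have hq := nQ_nonneg hk hk3 (sg_abs hk hk3 x)
  have h2 := mul_le_mul_of_nonneg_left h1 hq
  have hρ := rho_nonneg (y - x)
  have hJ := gJr_nonneg (rr x) hE
  have h3 : 0 ≤ nQ k (sg k x) * gJr (rr x) (nE k (sg k x)) * rho (y - x) := by positivity
  have e : rr y = rr x + (x 0 * (y - x) 0 / 5 + x 1 * (y - x) 1 + x 2 * (y - x) 2) + rho (y - x) := by
    simp [rr, rho]; ring
  rw [Hg_inner]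
  unfold GG nF Bc
  set σ := sg k x
  set w := x 0 * (y - x) 0 / 5 + x 1 * (y - x) 1 + x 2 * (y - x) 2 with hw
  have e2 : (y - x) 0 = y 0 - x 0 := by simp
  rw [e2]
  have e3 : rr y - rr x = w + rho (y - x) := by rw [e]; ring
  rw [e3] at h2
  have e4 : nX k σ * (rr y + 3 / 5) = nX k σ * (rr x + 3 / 5) + nX k σ * w + nX k σ * rho (y - x) := by
    rw [e]; ring
  nlinarith

lemma GG_subgrad' {k : ℝ} (hk : 5 / 2 ≤ k) (hk3 : k < 3) (x y : E3) :
    GG k x + ⟪Hg k x, y - x⟫ ≤ GG k y := by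
  have := GG_subgrad hk hk3 x y
  have := mul_nonneg (nX_nonneg k (sg k x)) (rho_nonneg (y - x))
  linarith

lemma GG_convex {k : ℝ} (hk : 5 / 2 ≤ k) (hk3 : k < 3) : ConvexOn ℝ univ (GG k) := by
  refine ⟨convex_univ, ?_⟩
  intro x _ y _ a b ha hb hab
  set z := a • x + b • y with hz
  have h1 := mul_le_mul_of_nonneg_left (GG_subgrad' hk hk3 z x) ha
  have h2 := mul_le_mul_of_nonneg_left (GG_subgrad' hk hk3 z y) hb
  have h3 : a * ⟪Hg k z, x - z⟫ + b * ⟪Hg k z, y - z⟫ = 0 := by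
    rw [← real_inner_smul_right, ← real_inner_smul_right, ← inner_add_right]
    have : a • (x - z) + b • (y - z) = (0 : E3) := by
      have : a • (x - z) + b • (y - z) = a • x + b • y - (a + b) • z := by module
      rw [this, hab, one_smul, ← hz, sub_self]
    rw [this, inner_zero_right]
  simp only [smul_eq_mul]
  have h4 : a * GG k z + b * GG k z = GG k z := by rw [← add_mul, hab, one_mul]
  nlinarith

lemma rpow_mix {t M α β : ℝ} (h0 : 0 ≤ t) (hM : t ≤ M) (hα : 0 < α) (hab : α ≤ β) :
    t ^ β ≤ M ^ (β - α) * t ^ α := by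
  rcases h0.eq_or_lt with rfl | h
  · rw [Real.zero_rpow (by linarith), Real.zero_rpow hα.ne']; simp
  · have : t ^ β = t ^ (β - α) * t ^ α := by rw [← Real.rpow_add h]; ring_nf
    rw [this]
    gcongr

lemma coord_le (x : E3) (i : Fin 3) : |x i| ≤ ‖x‖ := by
  have := PiLp.norm_apply_le x i
  simpa using this

lemma drho_norm (x : E3) : ‖drho x‖ ≤ ‖x‖ := by
  apply le_of_sq_le_sq _ (norm_nonneg x)
  rw [norm3_sq, norm3_sq]
  simp [drho]
  nlinarith [sq_nonneg (x 0)]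

lemma drho_sub (x y : E3) : drho x - drho y = drho (x - y) := by
  ext i; fin_cases i <;> simp [drho]; ring

lemma rr_diff {x y : E3} {R : ℝ} (hx : ‖x‖ ≤ R) (hy : ‖y‖ ≤ R) : |rr x - rr y| ≤ R * ‖x - y‖ := by
  have e : rr x - rr y = (1 / 2) * ⟪drho (x - y), x + y⟫ := by
    rw [inner3]; simp [rr, rho, drho]; ring
  rw [e, abs_mul]
  have h1 := abs_real_inner_le_norm (drho (x - y)) (x + y)
  have h2 := drho_norm (x - y)
  have h3 : ‖x + y‖ ≤ 2 * R := (norm_add_le _ _).trans (by linarith)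
  rw [abs_of_pos (by norm_num)]
  have h4 : ‖drho (x - y)‖ * ‖x + y‖ ≤ ‖x - y‖ * (2 * R) := by gcongr
  linarith

lemma Bc_abs {k : ℝ} (hk : 5 / 2 ≤ k) (hk3 : k < 3) (p : E3) : |Bc k p| ≤ 4 := by
  have hs := sg_abs hk hk3 p
  have hE := nE_nonneg hk3 (sg k p)
  have h1 := nX_nonneg k (sg k p)
  have h2 := nX_le_one hk (sg k p)
  have h3 := nQ_nonneg hk hk3 hs
  have h4 := nQ_le hk hk3 hs
  have h5 := gJr_nonneg (rr p) hE
  have h6 := gJr_le_one (rr p) hE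
  unfold Bc
  rw [abs_of_nonneg (by positivity)]
  nlinarith

lemma e0_norm : ‖e0‖ = 1 := by
  have h := norm3_sq e0
  have h2 : e0 0 ^ 2 + e0 1 ^ 2 + e0 2 ^ 2 = 1 := by simp [e0]
  rw [h2] at h
  exact (pow_eq_one_iff_of_nonneg (norm_nonneg _) two_ne_zero).1 h

lemma Hg_hoelder {k : ℝ} (hk : 5 / 2 ≤ k) (hk3 : k < 3) {α : ℝ} (hα : 0 < α) (hαk : α ≤ k / 3) {R : ℝ} (hR : 0 ≤ R) :
    ∃ C, 0 ≤ C ∧ ∀ x y : E3, ‖x‖ ≤ R → ‖y‖ ≤ R → ‖Hg k x - Hg k y‖ ≤ C * ‖x - y‖ ^ α := by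
  obtain ⟨C, hC, h⟩ := hoelder hk hk3
  set K := (1 + R) ^ (k / 3) with hK
  set M1 := (2 * R) ^ (k / 3 - α) with hM1
  set M2 := (2 * R) ^ (1 - α) with hM2
  have hK0 : 0 ≤ K := by positivity
  have hM10 : 0 ≤ M1 := by positivity
  have hM20 : 0 ≤ M2 := by positivity
  refine ⟨(1 + R) * (C * K * M1) + 4 * M2, by positivity, ?_⟩
  intro x y hx hy
  obtain ⟨_, h1, h2⟩ := h (x 0) (y 0) (rr x) (rr y) _ _ (rr_ge x) (rr_ge y) (sg_spec hk hk3 x) (sg_spec hk hk3 y)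
  set D := |x 0 - y 0| + |rr x - rr y| with hD
  set t := ‖x - y‖ with ht
  have ht0 : 0 ≤ t := norm_nonneg _
  have ht2 : t ≤ 2 * R := (norm_sub_le _ _).trans (by linarith)
  have hDt : D ≤ (1 + R) * t := by
    have a1 := coord_le (x - y) 0
    have a2 := rr_diff hx hy
    simp only [PiLp.sub_apply] at a1
    rw [hD]; linarith
  have hDk : D ^ (k / 3) ≤ K * M1 * t ^ α := by
    calc D ^ (k / 3) ≤ ((1 + R) * t) ^ (k / 3) :=
          Real.rpow_le_rpow (by positivity) hDt (by linarith)
      _ = K * t ^ (k / 3) := Real.mul_rpow (by linarith) ht0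
      _ ≤ K * (M1 * t ^ α) := by gcongr; exact rpow_mix ht0 ht2 hα hαk
      _ = _ := by ring
  have ht1 : t ≤ M2 * t ^ α := by
    have := rpow_mix (β := 1) ht0 ht2 hα (by linarith)
    rwa [Real.rpow_one] at this
  have hb : ‖Hg k x - Hg k y‖ ≤ |nZ k (sg k x) - nZ k (sg k y)| + |Bc k x - Bc k y| * R + 4 * t := by
    have e : Hg k x - Hg k y = (nZ k (sg k x) - nZ k (sg k y)) • e0 + (Bc k x - Bc k y) • drho x +
        Bc k y • drho (x - y) := by
      rw [← drho_sub]; unfold Hg; module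
    rw [e]
    refine (norm_add_le _ _).trans (add_le_add ((norm_add_le _ _).trans (add_le_add ?_ ?_)) ?_)
    · rw [norm_smul, e0_norm, mul_one, Real.norm_eq_abs]
    · rw [norm_smul, Real.norm_eq_abs]; gcongr; exact (drho_norm x).trans hx
    · rw [norm_smul, Real.norm_eq_abs]
      exact mul_le_mul (Bc_abs hk hk3 y) (drho_norm _) (norm_nonneg _) (by norm_num)
  refine hb.trans ?_
  have h2' : |Bc k x - Bc k y| ≤ C * D ^ (k / 3) := h2
  calc _ ≤ C * (K * M1 * t ^ α) + C * (K * M1 * t ^ α) * R + 4 * (M2 * t ^ α) := by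
        gcongr
        · exact h1.trans (by gcongr)
        · exact h2'.trans (by gcongr)
    _ = _ := by ring

lemma Hg_cont {k : ℝ} (hk : 5 / 2 ≤ k) (hk3 : k < 3) : Continuous (Hg k) := by
  rw [continuous_iff_continuousAt]
  intro x
  obtain ⟨C, hC, h⟩ := Hg_hoelder hk hk3 (α := k / 3) (by linarith) le_rfl (R := ‖x‖ + 1) (by positivity)
  rw [ContinuousAt, tendsto_iff_norm_sub_tendsto_zero]
  have hlim : Filter.Tendsto (fun y : E3 => C * ‖y - x‖ ^ (k / 3)) (nhds x) (nhds 0) := by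
    have hc : Continuous (fun y : E3 => C * ‖y - x‖ ^ (k / 3)) := by
      refine continuous_const.mul (Continuous.rpow_const (by fun_prop) (fun _ => Or.inr (by linarith)))
    have := hc.tendsto x
    simpa [Real.zero_rpow (show k / 3 ≠ 0 by linarith)] using this
  refine squeeze_zero' (Filter.Eventually.of_forall fun _ => norm_nonneg _) ?_ hlim
  filter_upwards [Metric.ball_mem_nhds x one_pos] with y hy
  apply h y x _ (by linarith)
  rw [mem_ball, dist_eq_norm] at hy
  have := norm_le_norm_add_norm_sub' y x
  linarith

lemma GG_grad {k : ℝ} (hk : 5 / 2 ≤ k) (hk3 : k < 3) (x : E3) : HasGradientAt (GG k) (Hg k x) x := by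
  rw [hasGradientAt_iff_isLittleO, Asymptotics.isLittleO_iff]
  intro c hc
  have := Metric.continuousAt_iff.1 ((Hg_cont hk hk3).continuousAt (x := x)) c hc
  obtain ⟨d, hd, hh⟩ := this
  filter_upwards [Metric.ball_mem_nhds x hd] with y hy
  have h1 := GG_subgrad' hk hk3 x y
  have h2 := GG_subgrad' hk hk3 y x
  have h3 : ⟪Hg k y, x - y⟫ = -⟪Hg k y, y - x⟫ := by rw [← inner_neg_right, neg_sub]
  have h4 := real_inner_le_norm (Hg k y - Hg k x) (y - x)
  rw [inner_sub_left] at h4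
  have h5 := hh hy
  rw [dist_eq_norm] at h5
  have h6 : ‖Hg k y - Hg k x‖ * ‖y - x‖ ≤ c * ‖y - x‖ := by gcongr
  rw [Real.norm_eq_abs, abs_of_nonneg (by linarith)]
  linarith

lemma GG_gradient {k : ℝ} (hk : 5 / 2 ≤ k) (hk3 : k < 3) (x : E3) : gradient (GG k) x = Hg k x :=
  (GG_grad hk hk3 x).gradient

lemma GG_diff {k : ℝ} (hk : 5 / 2 ≤ k) (hk3 : k < 3) : Differentiable ℝ (GG k) :=
  fun x => (GG_grad hk hk3 x).differentiableAt

lemma nT_one (k : ℝ) {σ : ℝ} (h : |σ| = 1) : nT k σ = 6 * k / 5 := by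
  unfold nT; rw [nS_eq_zero h.ge]; ring

lemma gJ_zero (r : ℝ) : gJ r 0 = max r 0 := by
  unfold gJ ge
  split_ifs with h
  · simp [h]
  · simp [max_eq_left (not_le.1 h).le]

lemma nE_one (k : ℝ) {σ : ℝ} (h : |σ| = 1) : nE k σ = 0 := by
  unfold nE; rw [nChi_eq_zero h.ge]; simp

lemma nTh_one {k : ℝ} (hk : 5 / 2 ≤ k) (Z r : ℝ) :
    nTh k Z r 1 = Z + 1 + (5 / 6 * r + (k - 5 / 6) * max r 0) := by
  have h1 : |(1 : ℝ)| = 1 := by simp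
  unfold nTh nXi nH
  rw [nE_one k h1, nT_one k h1, nQ_one, gJ_zero]
  have : k ≠ 0 := by linarith
  have e : k * 1 / (6 * k / 5) = 5 / 6 := by field_simp
  rw [e]
  norm_num [nZs, nY]; ring

lemma nTh_neg_one {k : ℝ} (hk : 5 / 2 ≤ k) (Z r : ℝ) :
    nTh k Z r (-1) = Z - 1 - (5 / 6 * r + (k - 5 / 6) * max r 0) := by
  have h1 : |(-1 : ℝ)| = 1 := by simp
  unfold nTh nXi nH
  rw [nE_one k h1, nT_one k h1, nQ_neg_one, gJ_zero]
  have : k ≠ 0 := by linarith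
  have e : k * (-1) / (6 * k / 5) = -(5 / 6) := by field_simp
  rw [e]
  norm_num [nZs, nY]; ring

def cA (k : ℝ) (p : E3) : ℝ := 5 / 6 * rr p + (k - 5 / 6) * max (rr p) 0
def A1 (k : ℝ) : Set E3 := {p | p 0 + 1 + cA k p ≤ 0}
def A2 (k : ℝ) : Set E3 := {p | -p 0 + 1 + cA k p ≤ 0}

lemma rr_cont : Continuous rr := by unfold rr rho; fun_prop
lemma cA_cont (k : ℝ) : Continuous (cA k) := by
  have := rr_cont
  unfold cA; fun_prop

lemma rr_convex : ConvexOn ℝ univ rr := by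
  refine ⟨convex_univ, ?_⟩
  intro x _ y _ a b ha hb hab
  have hb' : b = 1 - a := by linarith
  have e : a * rr x + b * rr y - rr (a • x + b • y) = a * b * rho (x - y) := by
    simp [rr, rho]; rw [hb']; ring
  have : 0 ≤ a * b * rho (x - y) := mul_nonneg (mul_nonneg ha hb) (rho_nonneg _)
  simp only [smul_eq_mul]
  linarith

lemma cA_convex {k : ℝ} (hk : 5 / 2 ≤ k) : ConvexOn ℝ univ (cA k) := by
  have h1 := rr_convex.smul (show (0 : ℝ) ≤ 5 / 6 by norm_num)
  have h2 := (rr_convex.sup (convexOn_const 0 convex_univ)).smul (show 0 ≤ k - 5 / 6 by linarith)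
  exact h1.add h2

lemma A1_convex {k : ℝ} (hk : 5 / 2 ≤ k) : Convex ℝ (A1 k) := by
  have h : ConvexOn ℝ univ (fun p : E3 => p 0 + 1 + cA k p) := by
    have h1 : ConvexOn ℝ univ (fun p : E3 => p 0 + 1) := by
      refine ⟨convex_univ, ?_⟩
      intro x _ y _ a b ha hb hab
      have hb' : b = 1 - a := by linarith
      apply le_of_eq; simp; rw [hb']; ring
    exact h1.add (cA_convex hk)
  have := h.convex_le 0
  simpa [A1] using this

lemma A2_convex {k : ℝ} (hk : 5 / 2 ≤ k) : Convex ℝ (A2 k) := by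
  have h : ConvexOn ℝ univ (fun p : E3 => -p 0 + 1 + cA k p) := by
    have h1 : ConvexOn ℝ univ (fun p : E3 => -p 0 + 1) := by
      refine ⟨convex_univ, ?_⟩
      intro x _ y _ a b ha hb hab
      have hb' : b = 1 - a := by linarith
      apply le_of_eq; simp; rw [hb']; ring
    exact h1.add (cA_convex hk)
  have := h.convex_le 0
  simpa [A2] using this

lemma cA_ge {k : ℝ} (hk : 5 / 2 ≤ k) (p : E3) : 5 / 6 * rr p ≤ cA k p := by
  unfold cA
  have : 0 ≤ (k - 5 / 6) * max (rr p) 0 := mul_nonneg (by linarith) (le_max_right _ _)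
  linarith

lemma bdd_aux {k : ℝ} (hk : 5 / 2 ≤ k) {p : E3} (h : cA k p ≤ |p 0| - 1) : ‖p‖ ≤ 13 := by
  have h1 := cA_ge hk p
  have h2 := coord_le p 0
  have h3 := norm3_sq p
  have h4 : ‖p‖ ^ 2 / 10 ≤ rho p := by
    rw [h3]; unfold rho; nlinarith [sq_nonneg (p 1), sq_nonneg (p 2)]
  unfold rr at h1
  nlinarith [norm_nonneg p]

lemma A1_compact {k : ℝ} (hk : 5 / 2 ≤ k) : IsCompact (A1 k) := by
  refine Metric.isCompact_of_isClosed_isBounded ?_ ?_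
  · have := cA_cont k
    exact isClosed_le (by fun_prop) continuous_const
  · refine (Metric.isBounded_closedBall (x := (0 : E3)) (r := 13)).subset ?_
    intro p hp
    rw [mem_closedBall_zero_iff]
    refine bdd_aux hk ?_
    have : p 0 + 1 + cA k p ≤ 0 := hp
    have := neg_abs_le (p 0)
    linarith

lemma A2_compact {k : ℝ} (hk : 5 / 2 ≤ k) : IsCompact (A2 k) := by
  refine Metric.isCompact_of_isClosed_isBounded ?_ ?_
  · have := cA_cont k
    exact isClosed_le (by fun_prop) continuous_const
  · refine (Metric.isBounded_closedBall (x := (0 : E3)) (r := 13)).subset ?_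
    intro p hp
    rw [mem_closedBall_zero_iff]
    refine bdd_aux hk ?_
    have : -p 0 + 1 + cA k p ≤ 0 := hp
    have := le_abs_self (p 0)
    linarith

lemma A_disjoint {k : ℝ} (hk : 5 / 2 ≤ k) : Disjoint (A1 k) (A2 k) := by
  rw [Set.disjoint_left]
  intro p h1 h2
  have h1' : p 0 + 1 + cA k p ≤ 0 := h1
  have h2' : -p 0 + 1 + cA k p ≤ 0 := h2
  have := cA_ge hk p
  have := rr_ge p
  linarith

lemma sg_eq {k : ℝ} (hk : 5 / 2 ≤ k) (hk3 : k < 3) {p : E3} {σ : ℝ} (h : IsSg k (p 0) (rr p) σ) :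
    sg k p = σ := IsSg_unique hk hk3 (rr_ge p) (sg_spec hk hk3 p) h

lemma sg_A1 {k : ℝ} (hk : 5 / 2 ≤ k) (hk3 : k < 3) {p : E3} (h : p ∈ A1 k) : sg k p = 1 := by
  apply sg_eq hk hk3
  refine ⟨by norm_num, le_rfl, fun h => absurd h (lt_irrefl _), fun _ => ?_⟩
  rw [nTh_one hk]; exact h

lemma sg_A2 {k : ℝ} (hk : 5 / 2 ≤ k) (hk3 : k < 3) {p : E3} (h : p ∈ A2 k) : sg k p = -1 := by
  apply sg_eq hk hk3
  refine ⟨le_rfl, by norm_num, fun _ => ?_, fun h => absurd h (lt_irrefl _)⟩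
  rw [nTh_neg_one hk]
  have h' : -p 0 + 1 + cA k p ≤ 0 := h
  unfold cA at h'; linarith

lemma sg_off {k : ℝ} (hk : 5 / 2 ≤ k) (hk3 : k < 3) {p : E3} (h : p ∉ A1 k ∪ A2 k) :
    |sg k p| < 1 ∧ nTh k (p 0) (rr p) (sg k p) = 0 := by
  have hs := sg_spec hk hk3 p
  have h1 : sg k p ≠ 1 := by
    intro e
    apply h; left
    have := hs.2.2.2 (by rw [e]; norm_num)
    rw [e, nTh_one hk] at this
    exact this
  have h2 : sg k p ≠ -1 := by
    intro e
    apply h; right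
    have := hs.2.2.1 (by rw [e]; norm_num)
    rw [e, nTh_neg_one hk] at this
    show -p 0 + 1 + cA k p ≤ 0
    unfold cA; linarith
  have a1 : sg k p < 1 := lt_of_le_of_ne hs.2.1 h1
  have a2 : -1 < sg k p := lt_of_le_of_ne hs.1 (Ne.symm h2)
  exact ⟨abs_lt.2 ⟨a2, a1⟩, le_antisymm (hs.2.2.2 a2) (hs.2.2.1 a1)⟩

lemma GG_edge {k : ℝ} (hk : 5 / 2 ≤ k) {p : E3} {s : ℝ} (hs : sg k p = s) (h1 : |s| = 1) :
    GG k p = ⟪nZ k s • e0, p⟫ + (-nD k s) := by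
  have hq : nQ k s = 0 := by
    rcases eq_or_eq_neg_of_abs_eq h1 with rfl | rfl
    · exact nQ_one k
    · exact nQ_neg_one k
  unfold GG nF
  rw [hs, hq, nX_eq_zero hk h1.ge, inner3]
  simp [e0]; ring

/-! ### Smoothness -/

lemma smS {σ : ℝ} (h : |σ| < 1) : ContDiffAt ℝ (⊤ : ℕ∞) nS σ := by
  have h1 : ContDiffAt ℝ (⊤ : ℕ∞) (fun t : ℝ => 1 - t ^ 2) σ := by fun_prop
  apply h1.congr_of_eventuallyEq
  filter_upwards [abs_lt_one_open h] with t ht using nS_eq ht.le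

lemma smM {σ : ℝ} (h : |σ| < 1) : ContDiffAt ℝ (⊤ : ℕ∞) nM σ := by
  unfold nM
  have := smS h
  have h0 := nS_nonneg σ
  exact ContDiffAt.div (by fun_prop) (by fun_prop) (by linarith)

lemma smPhi {σ : ℝ} (h : |σ| < 1) : ContDiffAt ℝ (⊤ : ℕ∞) nPhi σ := by
  unfold nPhi
  have := smS h
  have h0 := nS_nonneg σ
  exact ContDiffAt.div (by fun_prop) (by fun_prop) (by positivity)

lemma smChi {σ : ℝ} (h : |σ| < 1) : ContDiffAt ℝ (⊤ : ℕ∞) nChi σ := (smS h).mul (smPhi h)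

lemma smT (k : ℝ) {σ : ℝ} (h : |σ| < 1) : ContDiffAt ℝ (⊤ : ℕ∞) (nT k) σ := by
  unfold nT
  have := smS h
  fun_prop

lemma smXi {k : ℝ} (hk : 5 / 2 ≤ k) {σ : ℝ} (h : |σ| < 1) : ContDiffAt ℝ (⊤ : ℕ∞) (nXi k) σ := by
  unfold nXi
  exact ContDiffAt.div (by fun_prop) (smT k h) (by have := nT_ge hk σ; linarith)

lemma smChiPow (a : ℝ) {σ : ℝ} (h : |σ| < 1) : ContDiffAt ℝ (⊤ : ℕ∞) (fun σ => nChi σ ^ a) σ :=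
  (smChi h).rpow_const_of_ne (nChi_pos h).ne'

lemma smOm (k : ℝ) {σ : ℝ} (h : |σ| < 1) : ContDiffAt ℝ (⊤ : ℕ∞) (nOm k) σ :=
  (((smChiPow (k - 1) h).mul (smPhi h)).mul (smM h)).mul (smT k h)

lemma sm_prim {f f' : ℝ → ℝ} (hd : ∀ σ, HasDerivAt f (f' σ) σ)
    (h' : ∀ σ, |σ| < 1 → ContDiffAt ℝ (⊤ : ℕ∞) f' σ) {σ : ℝ} (h : |σ| < 1) :
    ContDiffAt ℝ (⊤ : ℕ∞) f σ := by
  have ho : IsOpen {σ : ℝ | |σ| < 1} := isOpen_lt continuous_abs continuous_const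
  have : ContDiffOn ℝ (⊤ : ℕ∞) f {σ : ℝ | |σ| < 1} := by
    rw [contDiffOn_infty_iff_deriv_of_isOpen ho]
    refine ⟨fun x _ => (hd x).differentiableAt.differentiableWithinAt, ?_⟩
    have e : deriv f = f' := by ext x; exact (hd x).deriv
    rw [e]
    exact fun x hx => (h' x hx).contDiffWithinAt
  exact this.contDiffAt (ho.mem_nhds h)

lemma smZ {k : ℝ} (hk : 5 / 2 ≤ k) {σ : ℝ} (h : |σ| < 1) : ContDiffAt ℝ (⊤ : ℕ∞) (nZ k) σ :=
  sm_prim (nZ_deriv hk) (fun _ h => (smOm k h).neg) h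

lemma smX (k : ℝ) {σ : ℝ} (h : |σ| < 1) : ContDiffAt ℝ (⊤ : ℕ∞) (nX k) σ := smChiPow k h

lemma smD {k : ℝ} (hk : 5 / 2 ≤ k) {σ : ℝ} (h : |σ| < 1) : ContDiffAt ℝ (⊤ : ℕ∞) (nD k) σ := by
  refine sm_prim (nD_deriv hk) (fun τ h => ?_) h
  have h1 := smOm k h
  have h2 := smXi hk h
  unfold nY nZs
  fun_prop

lemma smQ {k : ℝ} (hk : 5 / 2 ≤ k) {σ : ℝ} (h : |σ| < 1) : ContDiffAt ℝ (⊤ : ℕ∞) (nQ k) σ := by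
  refine sm_prim (nQ_deriv hk) (fun τ h => ?_) h
  have h1 := smOm k h
  have h2 := smXi hk h
  fun_prop

lemma smE (k : ℝ) {σ : ℝ} (h : |σ| < 1) : ContDiffAt ℝ (⊤ : ℕ∞) (nE k) σ := by
  unfold nE
  have := smChi h
  fun_prop

lemma smH {k : ℝ} (hk : 5 / 2 ≤ k) {σ : ℝ} (h : |σ| < 1) : ContDiffAt ℝ (⊤ : ℕ∞) (nH k) σ := by
  unfold nH
  have h1 := smChiPow (3 - k) h
  have h2 := smQ hk h
  have h3 : ContDiffAt ℝ (⊤ : ℕ∞) (fun σ => σ / nT k σ) σ :=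
    ContDiffAt.div (by fun_prop) (smT k h) (by have := nT_ge hk σ; linarith)
  exact (contDiffAt_const.mul h3).mul (h1.mul h2)

lemma sm_rr : ContDiff ℝ (⊤ : ℕ∞) rr := by unfold rr rho; fun_prop

/-- smoothness of `e(r(p), E(σ))` in both variables -/
lemma sm_ge {k : ℝ} (hk3 : k < 3) {u : E3 × ℝ} (h : |u.2| < 1) :
    ContDiffAt ℝ (⊤ : ℕ∞) (fun v : E3 × ℝ => ge (rr v.1) (nE k v.2)) u := by
  have h1 : ContDiffAt ℝ (⊤ : ℕ∞) (fun v : E3 × ℝ => expNegInvGlue (rr v.1 / nE k v.2)) u := by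
    refine expNegInvGlue.contDiff.contDiffAt.comp u (ContDiffAt.div ?_ ?_ (nE_pos hk3 h).ne')
    · exact (sm_rr.comp contDiff_fst).contDiffAt
    · exact (smE k h).comp u contDiffAt_snd
  apply h1.congr_of_eventuallyEq
  have ho : IsOpen {v : E3 × ℝ | |v.2| < 1} := isOpen_lt (by fun_prop) continuous_const
  filter_upwards [ho.mem_nhds h] with v hv
  exact ge_eq_glue _ (nE_pos hk3 hv)

lemma sm_Th {k : ℝ} (hk : 5 / 2 ≤ k) (hk3 : k < 3) {u : E3 × ℝ} (h : |u.2| < 1) :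
    ContDiffAt ℝ (⊤ : ℕ∞) (fun v : E3 × ℝ => nTh k (v.1 0) (rr v.1) v.2) u := by
  have h1 := sm_ge hk3 h
  have h2 : ContDiffAt ℝ (⊤ : ℕ∞) (fun v : E3 × ℝ => rr v.1) u := (sm_rr.comp contDiff_fst).contDiffAt
  have h3 : ContDiffAt ℝ (⊤ : ℕ∞) (fun v : E3 × ℝ => nXi k v.2) u := (smXi hk h).comp u contDiffAt_snd
  have h4 : ContDiffAt ℝ (⊤ : ℕ∞) (fun v : E3 × ℝ => nH k v.2) u := (smH hk h).comp u contDiffAt_snd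
  have h5 : ContDiffAt ℝ (⊤ : ℕ∞) (fun v : E3 × ℝ => v.1 0) u := by fun_prop
  unfold nTh gJ nZs nY
  fun_prop

lemma sm_F {k : ℝ} (hk : 5 / 2 ≤ k) (hk3 : k < 3) {u : E3 × ℝ} (h : |u.2| < 1) :
    ContDiffAt ℝ (⊤ : ℕ∞) (fun v : E3 × ℝ => nF k (v.1 0) (rr v.1) v.2) u := by
  have h1 := sm_ge hk3 h
  have h2 : ContDiffAt ℝ (⊤ : ℕ∞) (fun v : E3 × ℝ => rr v.1) u := (sm_rr.comp contDiff_fst).contDiffAt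
  have h3 : ContDiffAt ℝ (⊤ : ℕ∞) (fun v : E3 × ℝ => nZ k v.2) u := (smZ hk h).comp u contDiffAt_snd
  have h4 : ContDiffAt ℝ (⊤ : ℕ∞) (fun v : E3 × ℝ => nX k v.2) u := (smX k h).comp u contDiffAt_snd
  have h6 : ContDiffAt ℝ (⊤ : ℕ∞) (fun v : E3 × ℝ => nD k v.2) u := (smD hk h).comp u contDiffAt_snd
  have h7 : ContDiffAt ℝ (⊤ : ℕ∞) (fun v : E3 × ℝ => nQ k v.2) u := (smQ hk h).comp u contDiffAt_snd
  have h5 : ContDiffAt ℝ (⊤ : ℕ∞) (fun v : E3 × ℝ => v.1 0) u := by fun_prop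
  unfold nF gJ
  fun_prop

lemma sg_smooth {k : ℝ} (hk : 5 / 2 ≤ k) (hk3 : k < 3) {p : E3} (h : p ∉ A1 k ∪ A2 k) :
    ContDiffAt ℝ (⊤ : ℕ∞) (sg k) p := by
  obtain ⟨h1, h2⟩ := sg_off hk hk3 h
  set u : E3 × ℝ := (p, sg k p) with hu
  set f : E3 × ℝ → ℝ := fun v => nTh k (v.1 0) (rr v.1) v.2 with hf
  have cdf : ContDiffAt ℝ (⊤ : ℕ∞) f u := sm_Th hk hk3 h1
  have hn : ((⊤ : ℕ∞) : WithTop ℕ∞) ≠ 0 := by simp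
  obtain ⟨D, hD, hD2⟩ := nTh_deriv hk hk3 (p 0) (rr_ge p) h1
  have hDp : 0 < D := by
    refine lt_of_lt_of_le ?_ hD2
    have a1 := (sq_lt_one_iff_abs_lt_one _).2 h1
    have : 0 < 1 - sg k p ^ 2 := by linarith
    have : 0 < 3 - k := by linarith
    positivity
  have hL : fderiv ℝ f u ∘L .inr ℝ E3 ℝ = D • ContinuousLinearMap.id ℝ ℝ := by
    have hfd := (cdf.differentiableAt hn).hasFDerivAt
    have hc : HasFDerivAt (fun t : ℝ => (p, t)) (ContinuousLinearMap.inr ℝ E3 ℝ) (sg k p) :=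
      hasFDerivAt_prodMk_right p (sg k p)
    have hcomp := hfd.comp (sg k p) hc
    have hD' : HasFDerivAt (nTh k (p 0) (rr p)) _ (sg k p) := hD.hasFDerivAt
    have := hcomp.unique hD'
    rw [this]; ext; simp
  have inv : (fderiv ℝ f u ∘L .inr ℝ E3 ℝ).IsInvertible := by
    rw [hL]
    refine ⟨ContinuousLinearEquiv.unitsEquivAut ℝ (Units.mk0 D hDp.ne'), ?_⟩
    ext; simp
  have hφ := cdf.contDiffAt_implicitFunction hn inv
  have hφ1 := cdf.eventually_apply_implicitFunction hn inv
  have hφ2 : cdf.implicitFunction hn inv u.1 = u.2 := cdf.implicitFunction_apply_self hn inv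
  apply hφ.congr_of_eventuallyEq
  have hcont := hφ.continuousAt.tendsto
  rw [hφ2] at hcont
  have hev := hcont.eventually (abs_lt_one_open h1)
  filter_upwards [hφ1, hev] with q hq1 hq2
  apply sg_eq hk hk3
  have h0 : nTh k (q 0) (rr q) (cdf.implicitFunction hn inv q) = 0 := by
    have : f u = 0 := h2
    rw [← this]; exact hq1
  exact ⟨(abs_lt.1 hq2).1.le, (abs_lt.1 hq2).2.le, fun _ => h0.ge, fun _ => h0.le⟩

lemma GG_smooth {k : ℝ} (hk : 5 / 2 ≤ k) (hk3 : k < 3) {p : E3} (h : p ∉ A1 k ∪ A2 k) :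
    ContDiffAt ℝ (⊤ : ℕ∞) (GG k) p := by
  have h1 := (sg_off hk hk3 h).1
  exact (sm_F hk hk3 (u := (p, sg k p)) h1).comp p (contDiffAt_id.prodMk (sg_smooth hk hk3 h))

lemma rho_pos {ξ : E3} (h : ξ ≠ 0) : 0 < rho ξ := by
  have h3 := norm3_sq ξ
  have h4 : ‖ξ‖ ^ 2 / 10 ≤ rho ξ := by
    rw [h3]; unfold rho; nlinarith [sq_nonneg (ξ 1), sq_nonneg (ξ 2)]
  have : 0 < ‖ξ‖ := norm_pos_iff.2 h
  have : 0 < ‖ξ‖ ^ 2 / 10 := by positivity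
  linarith

lemma GG_hess {k : ℝ} (hk : 5 / 2 ≤ k) (hk3 : k < 3) {p : E3} (h : p ∉ A1 k ∪ A2 k) {ξ : E3}
    (hξ : ξ ≠ 0) : 0 < iteratedFDeriv ℝ 2 (GG k) p ![ξ, ξ] := by
  have h1 := (sg_off hk hk3 h).1
  have hsm := GG_smooth hk hk3 h
  have hx := nX_pos k h1
  rw [iteratedFDeriv_two_apply]
  simp only [Matrix.cons_val_zero, Matrix.cons_val_one]
  have hd1 : DifferentiableAt ℝ (fderiv ℝ (GG k)) p :=
    (hsm.fderiv_right (m := 1) (by norm_cast)).differentiableAt (by norm_num)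
  have hline : HasDerivAt (fun t : ℝ => p + t • ξ) ξ 0 := by
    simpa using ((hasDerivAt_id (0 : ℝ)).smul_const ξ).const_add p
  have hd1' : HasFDerivAt (fderiv ℝ (GG k)) (fderiv ℝ (fderiv ℝ (GG k)) p) (p + (0 : ℝ) • ξ) := by
    simpa using hd1.hasFDerivAt
  have hm : HasDerivAt (fun t : ℝ => fderiv ℝ (GG k) (p + t • ξ) ξ)
      (fderiv ℝ (fderiv ℝ (GG k)) p ξ ξ) 0 := by
    have := hd1'.comp_hasDerivAt (0 : ℝ) hline
    have h2 := this.clm_apply (hasDerivAt_const (0 : ℝ) ξ)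
    simpa using h2
  have hval : ∀ y, fderiv ℝ (GG k) y ξ = ⟪Hg k y, ξ⟫ := by
    intro y
    rw [(GG_grad hk hk3 y).hasFDerivAt.fderiv]; simp
  have hρ := rho_pos hξ
  have key : nX k (sg k p) * rho ξ ≤ fderiv ℝ (fderiv ℝ (GG k)) p ξ ξ := by
    have ht := hm.hasDerivWithinAt (s := Ioi 0)
    rw [hasDerivWithinAt_iff_tendsto_slope' (by simp)] at ht
    refine ge_of_tendsto ht ?_
    filter_upwards [self_mem_nhdsWithin] with t ht
    have ht0 : (0 : ℝ) < t := ht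
    rw [slope_def_field]
    simp only [hval, zero_smul, add_zero, sub_zero]
    rw [le_div_iff₀ ht0]
    have s1 := GG_subgrad hk hk3 p (p + t • ξ)
    have s2 := GG_subgrad' hk hk3 (p + t • ξ) p
    have e1 : p + t • ξ - p = t • ξ := by abel
    have e2 : p - (p + t • ξ) = -(t • ξ) := by abel
    rw [e1, real_inner_smul_right] at s1
    rw [e2, inner_neg_right, real_inner_smul_right] at s2
    have e3 : rho (t • ξ) = t ^ 2 * rho ξ := by simp [rho]; ring
    rw [e3] at s1
    have : t * (nX k (sg k p) * rho ξ * t) ≤ t * (⟪Hg k (p + t • ξ), ξ⟫ - ⟪Hg k p, ξ⟫) := by nlinarith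
    exact le_of_mul_le_mul_left this ht0
  have : 0 < nX k (sg k p) * rho ξ := by positivity
  linarith

def sgm (x : E3) : ℝ := Real.sqrt 2 * x 0 / ‖x‖
def gu (x : E3) : E3 := !₂[nZs (sgm x), (1 + sgm x ^ 2) / Real.sqrt 2 * (x 1 / ‖x‖),
  (1 + sgm x ^ 2) / Real.sqrt 2 * (x 2 / ‖x‖)]

lemma norm_grad {x : E3} (hx : x ≠ 0) :
    HasFDerivAt (fun y : E3 => ‖y‖) ((1 / ‖x‖) • innerSL ℝ x) x := by
  have hn : 0 < ‖x‖ := norm_pos_iff.2 hx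
  have h1 := (hasStrictFDerivAt_norm_sq x).hasFDerivAt
  have h2 := h1.sqrt (by positivity)
  have e : (fun y : E3 => Real.sqrt (‖y‖ ^ 2)) = fun y => ‖y‖ := by
    ext y; exact Real.sqrt_sq (norm_nonneg y)
  rw [e, Real.sqrt_sq hn.le] at h2
  have e3 : (1 / (2 * ‖x‖)) • 2 • innerSL ℝ x = (1 / ‖x‖) • innerSL ℝ x := by
    rw [← Nat.cast_smul_eq_nsmul ℝ, smul_smul]
    congr 1
    push_cast
    field_simp
  rw [← e3]
  exact h2

lemma norm_inv_grad {x : E3} (hx : x ≠ 0) :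
    HasFDerivAt (fun y : E3 => ‖y‖⁻¹) ((-(‖x‖ ^ 2)⁻¹) • ((1 / ‖x‖) • innerSL ℝ x)) x := by
  have hn : 0 < ‖x‖ := norm_pos_iff.2 hx
  exact (hasDerivAt_inv hn.ne').comp_hasFDerivAt x (norm_grad hx)

lemma coord_fd (i : Fin 3) (x : E3) :
    HasFDerivAt (fun y : E3 => y i) (EuclideanSpace.proj i : E3 →L[ℝ] ℝ) x :=
  (EuclideanSpace.proj i : E3 →L[ℝ] ℝ).hasFDerivAt

lemma sgm_sq {x : E3} (hx : x ≠ 0) : sgm x ^ 2 * ‖x‖ ^ 2 = 2 * x 0 ^ 2 := by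
  have hn : 0 < ‖x‖ := norm_pos_iff.2 hx
  have h2 : Real.sqrt 2 ^ 2 = 2 := Real.sq_sqrt (by norm_num)
  unfold sgm
  field_simp
  rw [h2]; ring

lemma u0_grad {x : E3} (hx : x ≠ 0) : HasGradientAt u0 (gu x) x := by
  have hn : 0 < ‖x‖ := norm_pos_iff.2 hx
  have hs : 0 < Real.sqrt 2 := by positivity
  have h2 : Real.sqrt 2 ^ 2 = 2 := Real.sq_sqrt (by norm_num)
  have hN := (((coord_fd 1 x).pow 2).add ((coord_fd 2 x).pow 2)).sub ((coord_fd 0 x).pow 2)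
  have h := hN.mul ((norm_inv_grad hx).const_mul (Real.sqrt 2)⁻¹)
  rw [hasGradientAt_iff_hasFDerivAt]
  have eu : u0 = (((fun y : E3 => y 1 ^ 2) + fun y : E3 => y 2 ^ 2) - fun y : E3 => y 0 ^ 2) *
      (fun y : E3 => (Real.sqrt 2)⁻¹ * ‖y‖⁻¹) := by
    ext y; simp [u0, div_eq_mul_inv, mul_comm]
  rw [eu]
  refine h.congr_fderiv ?_
  ext v
  have hn3 : ‖x‖ ^ 2 = x 0 ^ 2 + x 1 ^ 2 + x 2 ^ 2 := norm3_sq x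
  have hg0 : gu x 0 = nZs (sgm x) := by simp [gu]
  have hg1 : gu x 1 = (1 + sgm x ^ 2) / Real.sqrt 2 * (x 1 / ‖x‖) := by simp [gu]
  have hg2 : gu x 2 = (1 + sgm x ^ 2) / Real.sqrt 2 * (x 2 / ‖x‖) := by simp [gu]
  have h3 : Real.sqrt 2 ^ 3 = 2 * Real.sqrt 2 := by rw [pow_succ, h2]
  have h4 : Real.sqrt 2 ^ 4 = 4 := by
    rw [show Real.sqrt 2 ^ 4 = (Real.sqrt 2 ^ 2) ^ 2 by ring, h2]; norm_num
  simp [inner3, hg0, hg1, hg2, nZs, sgm]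
  field_simp
  have e4 : x 1 ^ 2 = ‖x‖ ^ 2 - x 0 ^ 2 - x 2 ^ 2 := by linarith
  simp only [e4, h2, h4]
  ring_nf

lemma gu_rr {x : E3} (hx : x ≠ 0) : rr (gu x) = -nY (sgm x) := by
  have hn : 0 < ‖x‖ := norm_pos_iff.2 hx
  have hn2 : ‖x‖ ^ 2 ≠ 0 := by positivity
  have h2 : Real.sqrt 2 ^ 2 = 2 := Real.sq_sqrt (by norm_num)
  have hn3 : ‖x‖ ^ 2 = x 0 ^ 2 + x 1 ^ 2 + x 2 ^ 2 := norm3_sq x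
  have hσ := sgm_sq hx
  have e : (x 1 / ‖x‖) ^ 2 + (x 2 / ‖x‖) ^ 2 = 1 - sgm x ^ 2 / 2 := by
    rw [div_pow, div_pow, ← add_div, div_eq_iff hn2]
    linarith
  have e2 : ((1 + sgm x ^ 2) / Real.sqrt 2) ^ 2 = (1 + sgm x ^ 2) ^ 2 / 2 := by
    rw [div_pow, h2]
  have : rr (gu x) = (((1 + sgm x ^ 2) / Real.sqrt 2) ^ 2 *
      ((x 1 / ‖x‖) ^ 2 + (x 2 / ‖x‖) ^ 2) + nZs (sgm x) ^ 2 / 5) / 2 - 3 / 5 := by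
    simp [rr, rho, gu]; ring
  rw [this, e, e2]
  unfold nZs nY; ring

lemma nY_nonneg (σ : ℝ) : 0 ≤ nY σ := by unfold nY; positivity

lemma gu_zero (x : E3) : gu x 0 = nZs (sgm x) := by simp [gu]

lemma edge_poly {τ : ℝ} (h : 1 ≤ τ) : -(τ * (3 - τ ^ 2) / 2) + 1 - 5 / 6 * ((1 - τ ^ 2) ^ 2 * (7 + 2 * τ ^ 2) / 20) ≤ 0 := by
  have e : -(τ * (3 - τ ^ 2) / 2) + 1 - 5 / 6 * ((1 - τ ^ 2) ^ 2 * (7 + 2 * τ ^ 2) / 20) =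
    -((τ - 1) ^ 2 / 24 * ((τ + 1) ^ 2 * (7 + 2 * τ ^ 2) - 12 * (τ + 2))) := by ring
  rw [e]
  have : 0 ≤ (τ + 1) ^ 2 * (7 + 2 * τ ^ 2) - 12 * (τ + 2) := by
    have : 4 ≤ (τ + 1) ^ 2 := by nlinarith
    have : 9 ≤ 7 + 2 * τ ^ 2 := by nlinarith
    nlinarith [mul_nonneg (show 0 ≤ (τ + 1) ^ 2 - 4 by linarith) (show 0 ≤ 7 + 2 * τ ^ 2 - 9 by linarith)]
  have : 0 ≤ (τ - 1) ^ 2 / 24 * ((τ + 1) ^ 2 * (7 + 2 * τ ^ 2) - 12 * (τ + 2)) := by positivity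
  linarith

lemma gu_A1 {k : ℝ} {x : E3} (hx : x ≠ 0) (h : 1 ≤ sgm x) : gu x ∈ A1 k := by
  show gu x 0 + 1 + cA k (gu x) ≤ 0
  have h0 := nY_nonneg (sgm x)
  unfold cA
  rw [gu_rr hx, gu_zero, max_eq_right (by linarith)]
  have := edge_poly h
  unfold nZs nY; linarith

lemma gu_A2 {k : ℝ} {x : E3} (hx : x ≠ 0) (h : sgm x ≤ -1) : gu x ∈ A2 k := by
  show -gu x 0 + 1 + cA k (gu x) ≤ 0
  have h0 := nY_nonneg (sgm x)
  unfold cA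
  rw [gu_rr hx, gu_zero, max_eq_right (by linarith)]
  have := edge_poly (show 1 ≤ -sgm x by linarith)
  simp only [neg_sq] at this
  unfold nZs nY; linarith

lemma nZ_const {k : ℝ} (hk : 5 / 2 ≤ k) {a b : ℝ} (h : ∀ t ∈ uIcc a b, 1 ≤ |t|) : nZ k b = nZ k a := by
  have e : nZ k b - nZ k a = ∫ t in a..b, -nOm k t := by
    unfold nZ
    rw [intervalIntegral.integral_interval_sub_left] <;>
      exact (nOm_cont hk).neg.intervalIntegrable _ _
  have : ∫ t in a..b, -nOm k t = ∫ t in a..b, (0 : ℝ) := by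
    apply intervalIntegral.integral_congr
    intro t ht
    simp [nOm_eq_zero hk (h t ht)]
  rw [this] at e
  simp at e
  linarith

def XX (k : ℝ) (x : E3) : E3 := nZ k (sgm x) • e0 + nX k (sgm x) • drho (gu x)

lemma Hg_gu {k : ℝ} (hk : 5 / 2 ≤ k) (hk3 : k < 3) {x : E3} (hx : x ≠ 0) : Hg k (gu x) = XX k x := by
  have hr : rr (gu x) ≤ 0 := by rw [gu_rr hx]; linarith [nY_nonneg (sgm x)]
  unfold Hg XX Bc
  rw [gJr_of_nonpos hr, mul_zero, add_zero]
  rcases lt_or_ge |sgm x| 1 with h | h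
  · have : sg k (gu x) = sgm x := by
      apply sg_eq hk hk3
      have h0 : nTh k (gu x 0) (rr (gu x)) (sgm x) = 0 := by
        unfold nTh
        rw [gJ_of_nonpos hr, ge_of_nonpos hr, gu_rr hx, gu_zero]; ring
      exact ⟨(abs_lt.1 h).1.le, (abs_lt.1 h).2.le, fun _ => h0.ge, fun _ => h0.le⟩
    rw [this]
  · rcases le_abs.1 h with h' | h'
    · rw [sg_A1 hk hk3 (gu_A1 hx h'), nX_eq_zero hk h, nX_eq_zero hk (by simp)]
      rw [nZ_const hk (a := 1) (b := sgm x)]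
      intro t ht
      rw [uIcc_of_le h'] at ht
      exact ht.1.trans (le_abs_self t)
    · have h'' : sgm x ≤ -1 := by linarith
      rw [sg_A2 hk hk3 (gu_A2 hx h''), nX_eq_zero hk h, nX_eq_zero hk (by simp)]
      rw [nZ_const hk (a := -1) (b := sgm x)]
      intro t ht
      rw [uIcc_of_ge h''] at ht
      have := neg_le_abs t
      linarith [ht.2]

lemma K0_sub {k : ℝ} : {p : E3 | ∃ x : E3, x ≠ 0 ∧ (x 1) ^ 2 + (x 2) ^ 2 < (x 0) ^ 2 ∧
    gradient u0 x = p} ⊆ A1 k ∪ A2 k := by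
  rintro p ⟨x, hx, hlt, rfl⟩
  rw [(u0_grad hx).gradient]
  have h1 := sgm_sq hx
  have h2 := norm3_sq x
  have hn : 0 < ‖x‖ := norm_pos_iff.2 hx
  have h3 : 1 ≤ |sgm x| := by
    rw [← one_le_sq_iff_one_le_abs]
    by_contra hc
    push Not at hc
    have : sgm x ^ 2 * ‖x‖ ^ 2 < 1 * ‖x‖ ^ 2 := by
      apply mul_lt_mul_of_pos_right hc; positivity
    linarith
  rcases le_abs.1 h3 with h | h
  · exact Or.inl (gu_A1 hx h)
  · exact Or.inr (gu_A2 hx (by linarith))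

lemma aesm_off_zero {f : E3 → ℝ} (hf : ContinuousOn f {0}ᶜ) : AEStronglyMeasurable f volume := by
  have h1 : AEStronglyMeasurable f (volume.restrict ({0}ᶜ : Set E3)) :=
    hf.aestronglyMeasurable (measurableSet_singleton 0).compl
  have h2 : (volume.restrict ({0}ᶜ : Set E3)) = (volume : Measure E3) :=
    restrict_compl_singleton 0
  rwa [h2] at h1

lemma bdd_mul_int {f g : E3 → ℝ} {C : ℝ} (hf : ContinuousOn f {0}ᶜ) (hb : ∀ x, |f x| ≤ C)
    (hg : Continuous g) (hc : HasCompactSupport g) : Integrable (fun x => f x * g x) := by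
  refine (hg.integrable_of_hasCompactSupport hc).bdd_mul (c := C) (aesm_off_zero hf) ?_
  exact Filter.Eventually.of_forall fun x => by simpa using hb x

lemma fderiv_app_cont {g : E3 → ℝ} (hg : ContDiff ℝ 1 g) (v : E3) :
    Continuous (fun x => fderiv ℝ g x v) :=
  (hg.continuous_fderiv (by simp)).clm_apply continuous_const

lemma fderiv_app_supp {g : E3 → ℝ} (hc : HasCompactSupport g) (v : E3) :
    HasCompactSupport (fun x => fderiv ℝ g x v) :=
  hc.fderiv_apply ℝ v

lemma stepA {f : Fin 3 → E3 → ℝ} {f' : Fin 3 → E3 → (E3 →L[ℝ] ℝ)} {e : Fin 3 → E3} {C : ℝ}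
    (hf : ∀ i x, x ≠ 0 → HasFDerivAt (f i) (f' i x) x)
    (hf' : ∀ i x, x ≠ 0 → ContinuousAt (f' i) x) (hb : ∀ i x, |f i x| ≤ C)
    (hdiv : ∀ x, x ≠ 0 → ∑ i, f' i x (e i) = 0)
    {g : E3 → ℝ} (hg : ContDiff ℝ 1 g) (hc : HasCompactSupport g) (h0 : (0 : E3) ∉ tsupport g) :
    ∫ x, ∑ i, f i x * fderiv ℝ g x (e i) = 0 := by
  have hcont : ∀ i, ContinuousOn (f i) {0}ᶜ := fun i x hx =>
    (hf i x hx).continuousAt.continuousWithinAt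
  have hI : ∀ i, Integrable (fun x => f i x * fderiv ℝ g x (e i)) := fun i =>
    bdd_mul_int (hcont i) (hb i) (fderiv_app_cont hg _) (fderiv_app_supp hc _)
  have hI2 : ∀ i, Integrable (fun x => f' i x (e i) * g x) := by
    intro i
    apply Continuous.integrable_of_hasCompactSupport
    · rw [continuous_iff_continuousAt]
      intro x
      by_cases hx : x ∈ tsupport g
      · have hx0 : x ≠ 0 := fun h => h0 (h ▸ hx)
        exact ((hf' i x hx0).clm_apply continuousAt_const).mul hg.continuous.continuousAt
      · have : (fun x => f' i x (e i) * g x) =ᶠ[nhds x] fun _ => 0 := by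
          filter_upwards [notMem_tsupport_iff_eventuallyEq.1 hx] with y hy
          simp [hy]
        exact continuousAt_const.congr this.symm
    · exact hc.mul_left
  rw [integral_finsetSum _ (fun i _ => hI i)]
  have hp : ∀ i, ∫ x, f i x * fderiv ℝ g x (e i) = - ∫ x, f' i x (e i) * g x := by
    intro i
    have := integral_bilinear_hasFDerivAt_right_eq_neg_left_of_integrable (μ := (volume : Measure E3))
      (f := f i) (f' := f' i) (g := g) (g' := fderiv ℝ g) (v := e i)
      (B := ContinuousLinearMap.mul ℝ ℝ) (by simpa using hI2 i) (by simpa using hI i)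
      (by simpa using bdd_mul_int (hcont i) (hb i) hg.continuous hc)
      (fun x hx => hf i x (fun h => h0 (h ▸ hx)))
      (fun x _ => (hg.differentiable (by simp) x).hasFDerivAt)
    simpa using this
  simp_rw [hp]
  rw [Finset.sum_neg_distrib, ← integral_finsetSum _ (fun i _ => hI2 i), neg_eq_zero]
  rw [← integral_zero E3 ℝ]
  congr 1
  ext x
  by_cases hx : x = 0
  · have : g x = 0 := by
      rw [hx]; exact image_eq_zero_of_notMem_tsupport h0
    simp [this]
  · rw [← Finset.sum_mul, hdiv x hx, zero_mul]

lemma exists_bd {g : E3 → ℝ} (hg : ContDiff ℝ 1 g) (hc : HasCompactSupport g) :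
    ∃ M, 0 ≤ M ∧ (∀ x, |g x| ≤ M) ∧ ∀ x, ‖fderiv ℝ g x‖ ≤ M := by
  obtain ⟨M1, h1⟩ := hg.continuous.bounded_above_of_compact_support hc
  obtain ⟨M2, h2⟩ := (hg.continuous_fderiv (by simp)).bounded_above_of_compact_support (hc.fderiv ℝ)
  refine ⟨max M1 M2, (norm_nonneg _).trans ((h1 0).trans (le_max_left _ _)),
    fun x => (h1 x).trans (le_max_left _ _), fun x => (h2 x).trans (le_max_right _ _)⟩

lemma div_free_int {f : Fin 3 → E3 → ℝ} {f' : Fin 3 → E3 → (E3 →L[ℝ] ℝ)} {e : Fin 3 → E3} {C : ℝ}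
    (he : ∀ i, ‖e i‖ = 1)
    (hf : ∀ i x, x ≠ 0 → HasFDerivAt (f i) (f' i x) x)
    (hf' : ∀ i x, x ≠ 0 → ContinuousAt (f' i) x) (hb : ∀ i x, |f i x| ≤ C)
    (hdiv : ∀ x, x ≠ 0 → ∑ i, f' i x (e i) = 0)
    {ψ : E3 → ℝ} (hψ : ContDiff ℝ 1 ψ) (hc : HasCompactSupport ψ) :
    ∫ x, ∑ i, f i x * fderiv ℝ ψ x (e i) = 0 := by
  have hcont : ∀ i, ContinuousOn (f i) {0}ᶜ := fun i x hx =>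
    (hf i x hx).continuousAt.continuousWithinAt
  have hC : 0 ≤ C := (abs_nonneg _).trans (hb 0 0)
  let z : ContDiffBump (0 : E3) := ⟨1, 2, by norm_num, by norm_num⟩
  have hz : ContDiff ℝ 1 z := z.contDiff
  have hzc : HasCompactSupport z := z.hasCompactSupport
  obtain ⟨M, hM0, hM1, hM2⟩ := exists_bd hψ hc
  obtain ⟨N, hN0, hN1, hN2⟩ := exists_bd hz hzc
  have key : ∀ r : ℝ, 1 ≤ r → |∫ x, ∑ i, f i x * fderiv ℝ ψ x (e i)| ≤
      (3 * C * (2 * N * M)) * 8 * (volume.real (ball (0 : E3) 1)) * r⁻¹ ^ 2 := by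
    intro r hr
    have hr0 : 0 < r := by linarith
    set w : E3 → ℝ := fun x => z (r • x) * ψ x with hw
    have hzr : ContDiff ℝ 1 (fun x : E3 => z (r • x)) := hz.comp (contDiff_const_smul r)
    have hwd : ContDiff ℝ 1 w := hzr.mul hψ
    have hwc : HasCompactSupport w := hc.mul_left
    have hgd : ContDiff ℝ 1 (fun x => ψ x - w x) := hψ.sub hwd
    have hgc : HasCompactSupport (fun x => ψ x - w x) := hc.sub hwc
    have h0 : (0 : E3) ∉ tsupport (fun x => ψ x - w x) := by
      rw [notMem_tsupport_iff_eventuallyEq]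
      filter_upwards [ball_mem_nhds (0 : E3) (inv_pos.2 hr0)] with x hx
      have : z (r • x) = 1 := by
        apply z.one_of_mem_closedBall
        simp only [mem_ball, dist_zero_right] at hx
        simp only [mem_closedBall, dist_zero_right, norm_smul, Real.norm_eq_abs, abs_of_pos hr0]
        show r * ‖x‖ ≤ 1
        calc r * ‖x‖ ≤ r * r⁻¹ := by gcongr
          _ = 1 := mul_inv_cancel₀ hr0.ne'
      simp [hw, this]
    have hA := stepA hf hf' hb hdiv hgd hgc h0
    have hIw : Integrable (fun x => ∑ i, f i x * fderiv ℝ w x (e i)) :=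
      integrable_finsetSum _ fun i _ =>
        bdd_mul_int (hcont i) (hb i) (fderiv_app_cont hwd _) (fderiv_app_supp hwc _)
    have hIg : Integrable (fun x => ∑ i, f i x * fderiv ℝ (fun x => ψ x - w x) x (e i)) :=
      integrable_finsetSum _ fun i _ =>
        bdd_mul_int (hcont i) (hb i) (fderiv_app_cont hgd _) (fderiv_app_supp hgc _)
    have hsplit : ∫ x, ∑ i, f i x * fderiv ℝ ψ x (e i) = ∫ x, ∑ i, f i x * fderiv ℝ w x (e i) := by
      rw [← zero_add (∫ x, ∑ i, f i x * fderiv ℝ w x (e i)), ← hA, ← integral_add hIg hIw]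
      congr 1
      ext x
      rw [← Finset.sum_add_distrib]
      refine Finset.sum_congr rfl fun i _ => ?_
      rw [fderiv_fun_sub (hψ.differentiable (by simp) x) (hwd.differentiable (by simp) x)]
      simp
      ring
    rw [hsplit]
    have hsupp : ∀ x, x ∉ closedBall (0 : E3) (2 * r⁻¹) → fderiv ℝ w x = 0 := by
      intro x hx
      have : w =ᶠ[nhds x] fun _ => 0 := by
        filter_upwards [isClosed_closedBall.isOpen_compl.mem_nhds hx] with y hy
        have : z (r • y) = 0 := by
          apply z.zero_of_le_dist
          simp only [mem_compl_iff, mem_closedBall, dist_zero_right, not_le] at hy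
          simp only [dist_zero_right, norm_smul, Real.norm_eq_abs, abs_of_pos hr0]
          show 2 ≤ r * ‖y‖
          calc 2 = r * (2 * r⁻¹) := by field_simp
            _ ≤ r * ‖y‖ := by gcongr
        simp [hw, this]
      rw [this.fderiv_eq]; simp
    have hbd : ∀ x, ‖fderiv ℝ w x‖ ≤ 2 * N * M * r := by
      intro x
      have h1 : HasFDerivAt (fun x : E3 => z (r • x)) ((fderiv ℝ z (r • x)).comp (r • ContinuousLinearMap.id ℝ E3)) x :=
        (hz.differentiable (by simp) (r • x)).hasFDerivAt.comp x ((hasFDerivAt_id x).const_smul r)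
      have h2 := h1.mul (hψ.differentiable (by simp) x).hasFDerivAt
      have h3 : fderiv ℝ w x = _ := h2.fderiv
      rw [h3]
      have h4 : ‖(fderiv ℝ z (r • x)).comp (r • ContinuousLinearMap.id ℝ E3)‖ ≤ N * r := by
        rw [ContinuousLinearMap.comp_smul, ContinuousLinearMap.comp_id, norm_smul, Real.norm_eq_abs,
          abs_of_pos hr0, mul_comm]
        gcongr
        exact hN2 _
      calc _ ≤ ‖z (r • x) • fderiv ℝ ψ x‖ + ‖ψ x • (fderiv ℝ z (r • x)).comp (r • ContinuousLinearMap.id ℝ E3)‖ :=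
            norm_add_le _ _
        _ ≤ N * M + M * (N * r) := by
            rw [norm_smul, norm_smul]
            gcongr
            · exact hN1 _
            · exact hM2 _
            · exact hM1 _
        _ ≤ 2 * N * M * r := by nlinarith [mul_nonneg (mul_nonneg hN0 hM0) (sub_nonneg.2 hr)]
    have hset : ∫ x, ∑ i, f i x * fderiv ℝ w x (e i) =
        ∫ x in closedBall (0 : E3) (2 * r⁻¹), ∑ i, f i x * fderiv ℝ w x (e i) := by
      rw [setIntegral_eq_integral_of_forall_compl_eq_zero]
      intro x hx
      simp [hsupp x hx]
    rw [hset, ← Real.norm_eq_abs]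
    have hle := norm_setIntegral_le_of_norm_le_const (μ := (volume : Measure E3))
      (s := closedBall (0 : E3) (2 * r⁻¹))
      (f := fun x => ∑ i, f i x * fderiv ℝ w x (e i)) (C := 3 * C * (2 * N * M * r))
      measure_closedBall_lt_top (fun x _ => by
        calc _ ≤ ∑ i : Fin 3, ‖f i x * fderiv ℝ w x (e i)‖ := norm_sum_le _ _
          _ ≤ ∑ i : Fin 3, C * (2 * N * M * r) := by
            refine Finset.sum_le_sum fun i _ => ?_
            rw [norm_mul]
            gcongr
            · exact hb i x
            · refine ((fderiv ℝ w x).le_opNorm _).trans ?_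
              rw [he, mul_one]; exact hbd x
          _ = 3 * C * (2 * N * M * r) := by simp; ring)
    refine hle.trans (le_of_eq ?_)
    rw [Measure.addHaar_real_closedBall _ _ (by positivity)]
    simp
    field_simp
    ring
  have hlim : Filter.Tendsto (fun r : ℝ => (3 * C * (2 * N * M)) * 8 * (volume.real (ball (0 : E3) 1)) * r⁻¹ ^ 2)
      Filter.atTop (nhds 0) := by
    simpa using (tendsto_inv_atTop_zero.pow 2).const_mul ((3 * C * (2 * N * M)) * 8 * (volume.real (ball (0 : E3) 1)))
  have := ge_of_tendsto hlim (by filter_upwards [Filter.eventually_ge_atTop 1] with r hr using key r hr)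
  exact abs_eq_zero.1 (le_antisymm this (abs_nonneg _))

def ej (i : Fin 3) : E3 := EuclideanSpace.single i 1

lemma ej_norm (i : Fin 3) : ‖ej i‖ = 1 := by simp [ej]

lemma ode {k : ℝ} (hk : 5 / 2 ≤ k) (σ : ℝ) :
    (2 - σ ^ 2) * (-nOm k σ + (-(nOm k σ * nXi k σ) * nZs σ + nX k σ * (-(3 / 2 * (1 - σ ^ 2)))) / 5)
      - σ * (2 - σ ^ 2) / 2 * (2 * σ * nX k σ + (1 + σ ^ 2) * (-(nOm k σ * nXi k σ)))
      + (1 + σ ^ 2) * (2 + σ ^ 2) / 2 * nX k σ = 0 := by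
  rcases lt_or_ge |σ| 1 with h | h
  · have hS := nS_eq h.le
    have hSp := nS_pos h
    have hc := nChi_pos h
    have hT := nT_ge hk σ
    have h1 : nOm k σ * nS σ = nX k σ * nM σ * nT k σ := by
      have e : nX k σ = nChi σ ^ (k - 1) * nChi σ := by
        unfold nX
        rw [← Real.rpow_add_one hc.ne']; congr 1; ring
      rw [e]; unfold nOm
      have : nChi σ = nS σ * nPhi σ := rfl
      nth_rewrite 3 [this]
      ring
    have h2 : nXi k σ * nT k σ = k * σ := by
      unfold nXi; field_simp
    have h3 : nM σ * (2 - σ ^ 2) = (2 / 5) * (5 - 7 * (1 - σ ^ 2) + 3 * (1 - σ ^ 2) ^ 2) := by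
      unfold nM
      rw [hS]
      have : 0 < 2 - σ ^ 2 := by rw [hS] at hSp; linarith
      have e : 1 + (1 - σ ^ 2) = 2 - σ ^ 2 := by ring
      rw [e]; field_simp
    have h4 : nT k σ = 1 + (4 * k / 5 - 1) * σ ^ 2 + (2 * k / 5) * (σ ^ 2) ^ 2 := by
      unfold nT; rw [hS]; ring
    rw [hS] at h1 hSp
    have h5 : nOm k σ * nXi k σ * (1 - σ ^ 2) = nX k σ * nM σ * (k * σ) := by
      rw [← h2]; linear_combination nXi k σ * h1
    apply mul_left_cancel₀ hSp.ne'
    rw [mul_zero]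
    unfold nZs
    linear_combination (-(2 - σ ^ 2)) * h1 + (2 - σ ^ 2) * (σ * (3 - σ ^ 2) / 10 + σ * (1 + σ ^ 2) / 2) * h5
      + nX k σ * (-nT k σ + k * σ * (σ * (3 - σ ^ 2) / 10 + σ * (1 + σ ^ 2) / 2)) * h3
      - nX k σ * ((2 / 5) * (5 - 7 * (1 - σ ^ 2) + 3 * (1 - σ ^ 2) ^ 2)) * h4
  · rw [nOm_eq_zero hk h, nX_eq_zero hk h]; ring

lemma nX_cd {k : ℝ} (hk : 5 / 2 ≤ k) : ContDiff ℝ 1 (nX k) := by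
  rw [contDiff_one_iff_deriv]
  refine ⟨fun σ => (nX_deriv hk σ).differentiableAt, ?_⟩
  have : deriv (nX k) = fun σ => -(nOm k σ * nXi k σ) := funext fun σ => (nX_deriv hk σ).deriv
  rw [this]
  exact ((nOm_cont hk).mul (nXi_cont hk)).neg

lemma nZ_cd {k : ℝ} (hk : 5 / 2 ≤ k) : ContDiff ℝ 1 (nZ k) := by
  rw [contDiff_one_iff_deriv]
  refine ⟨fun σ => (nZ_deriv hk σ).differentiableAt, ?_⟩
  have : deriv (nZ k) = fun σ => -nOm k σ := funext fun σ => (nZ_deriv hk σ).deriv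
  rw [this]
  exact (nOm_cont hk).neg

def fb (k σ : ℝ) : ℝ := nZ k σ + nX k σ * nZs σ / 5
def fc (k σ : ℝ) : ℝ := (1 + σ ^ 2) * nX k σ / Real.sqrt 2

lemma XX_0 (k : ℝ) (x : E3) : XX k x 0 = fb k (sgm x) := by
  simp [XX, e0, drho, gu, fb]; ring
lemma XX_1 (k : ℝ) (x : E3) : XX k x 1 = fc k (sgm x) * (x 1 * ‖x‖⁻¹) := by
  simp [XX, e0, drho, gu, fc]; ring
lemma XX_2 (k : ℝ) (x : E3) : XX k x 2 = fc k (sgm x) * (x 2 * ‖x‖⁻¹) := by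
  simp [XX, e0, drho, gu, fc]; ring

lemma fb_cd {k : ℝ} (hk : 5 / 2 ≤ k) : ContDiff ℝ 1 (fb k) := by
  have h1 := nX_cd hk
  have h2 := nZ_cd hk
  unfold fb nZs
  fun_prop
lemma fc_cd {k : ℝ} (hk : 5 / 2 ≤ k) : ContDiff ℝ 1 (fc k) := by
  have h1 := nX_cd hk
  unfold fc
  fun_prop

lemma ninv_cd {x : E3} (hx : x ≠ 0) : ContDiffAt ℝ 1 (fun y : E3 => ‖y‖⁻¹) x :=
  (contDiffAt_norm ℝ hx).inv (norm_ne_zero_iff.2 hx)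

lemma coord_cd (i : Fin 3) (x : E3) : ContDiffAt ℝ 1 (fun y : E3 => y i) x :=
  (EuclideanSpace.proj i : E3 →L[ℝ] ℝ).contDiff.contDiffAt

lemma sgm_cd {x : E3} (hx : x ≠ 0) : ContDiffAt ℝ 1 sgm x := by
  have e : sgm = fun y : E3 => Real.sqrt 2 * y 0 * ‖y‖⁻¹ := by
    ext y; simp [sgm, div_eq_mul_inv]
  rw [e]
  exact (contDiffAt_const.mul (coord_cd 0 x)).mul (ninv_cd hx)

lemma XX_cd {k : ℝ} (hk : 5 / 2 ≤ k) (i : Fin 3) {x : E3} (hx : x ≠ 0) :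
    ContDiffAt ℝ 1 (fun y => XX k y i) x := by
  have hs := sgm_cd hx
  have hn := ninv_cd hx
  have hb : ContDiffAt ℝ 1 (fun y => fb k (sgm y)) x := (fb_cd hk).contDiffAt.comp x hs
  have hc : ContDiffAt ℝ 1 (fun y => fc k (sgm y)) x := (fc_cd hk).contDiffAt.comp x hs
  fin_cases i
  · simpa only [Fin.zero_eta, XX_0] using hb
  · simpa only [Fin.mk_one, XX_1] using hc.mul ((coord_cd 1 x).mul hn)
  · have e : (fun y : E3 => XX k y 2) = fun y => fc k (sgm y) * (y 2 * ‖y‖⁻¹) := funext (XX_2 k)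
    show ContDiffAt ℝ 1 (fun y => XX k y 2) x
    rw [e]
    exact hc.mul ((coord_cd 2 x).mul hn)

lemma fb_deriv {k : ℝ} (hk : 5 / 2 ≤ k) (σ : ℝ) : HasDerivAt (fb k)
    (-nOm k σ + (-(nOm k σ * nXi k σ) * nZs σ + nX k σ * (-(3 / 2 * (1 - σ ^ 2)))) / 5) σ := by
  have hz : HasDerivAt nZs (-(3 / 2 * (1 - σ ^ 2))) σ := by
    have h := (((hasDerivAt_id σ).mul ((hasDerivAt_pow 2 σ).const_sub 3)).div_const 2).neg
    refine h.congr_deriv ?_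
    simp; ring
  exact (nZ_deriv hk σ).add (((nX_deriv hk σ).mul hz).div_const 5)

lemma fc_deriv {k : ℝ} (hk : 5 / 2 ≤ k) (σ : ℝ) : HasDerivAt (fc k)
    ((2 * σ * nX k σ + (1 + σ ^ 2) * (-(nOm k σ * nXi k σ))) / Real.sqrt 2) σ := by
  have h := ((((hasDerivAt_pow 2 σ).const_add 1).mul (nX_deriv hk σ)).div_const (Real.sqrt 2))
  refine h.congr_deriv ?_
  simp

lemma sgm_fd {x : E3} (hx : x ≠ 0) : ∃ L : E3 →L[ℝ] ℝ, HasFDerivAt sgm L x ∧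
    ∀ i, L (ej i) = Real.sqrt 2 * ((ej i) 0 * ‖x‖⁻¹) - sgm x * x i * ‖x‖⁻¹ ^ 2 := by
  have e : sgm = fun y : E3 => Real.sqrt 2 * (y 0 * ‖y‖⁻¹) := by
    ext y; simp [sgm, div_eq_mul_inv, mul_assoc]
  have h := ((coord_fd 0 x).mul (norm_inv_grad hx)).const_mul (Real.sqrt 2)
  refine ⟨_, by rw [e]; exact h, ?_⟩
  intro i
  have : ⟪x, ej i⟫ = x i := by simp [ej, EuclideanSpace.inner_single_right]
  simp [this, sgm]
  ring

lemma xn_fd {x : E3} (hx : x ≠ 0) (i : Fin 3) : ∃ L : E3 →L[ℝ] ℝ,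
    HasFDerivAt (fun y : E3 => y i * ‖y‖⁻¹) L x ∧
    L (ej i) = ‖x‖⁻¹ - x i ^ 2 * ‖x‖⁻¹ ^ 3 := by
  have h := ((coord_fd i x).mul (norm_inv_grad hx))
  refine ⟨_, h, ?_⟩
  have : ⟪x, ej i⟫ = x i := by simp [ej, EuclideanSpace.inner_single_right]
  have h1 : (ej i) i = 1 := by simp [ej]
  simp [this, h1]
  ring

lemma XX_div {k : ℝ} (hk : 5 / 2 ≤ k) {x : E3} (hx : x ≠ 0) :
    ∑ i, fderiv ℝ (fun y => XX k y i) x (ej i) = 0 := by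
  obtain ⟨L, hL, hLe⟩ := sgm_fd hx
  obtain ⟨M1, hM1, hM1e⟩ := xn_fd hx 1
  obtain ⟨M2, hM2, hM2e⟩ := xn_fd hx 2
  have hn : 0 < ‖x‖ := norm_pos_iff.2 hx
  have hB := (fb_deriv hk (sgm x)).comp_hasFDerivAt x hL
  have hC := (fc_deriv hk (sgm x)).comp_hasFDerivAt x hL
  have h1 := hC.mul hM1
  have h2 := hC.mul hM2
  have f0 : (fun y => XX k y 0) = fb k ∘ sgm := funext (XX_0 k)
  have f1 : (fun y => XX k y 1) = (fc k ∘ sgm) * fun y : E3 => y 1 * ‖y‖⁻¹ := funext (XX_1 k)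
  have f2 : (fun y => XX k y 2) = (fc k ∘ sgm) * fun y : E3 => y 2 * ‖y‖⁻¹ := funext (XX_2 k)
  rw [Fin.sum_univ_three, f0, f1, f2, hB.fderiv, h1.fderiv, h2.fderiv]
  have e00 : (ej 0) 0 = 1 := by simp [ej]
  have e10 : (ej 1) 0 = 0 := by simp [ej]
  have e20 : (ej 2) 0 = 0 := by simp [ej]
  have hode := ode hk (sgm x)
  have hs2 : Real.sqrt 2 ^ 2 = 2 := Real.sq_sqrt (by norm_num)
  have hs0 : 0 < Real.sqrt 2 := by positivity
  have hsq := sgm_sq hx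
  have hn3 := norm3_sq x
  have hx0 : x 0 = sgm x * ‖x‖ / Real.sqrt 2 := by unfold sgm; field_simp
  simp only [_root_.add_apply, _root_.smul_apply, smul_eq_mul, hLe, hM1e, hM2e,
    e00, e10, e20, Function.comp]
  set B := -nOm k (sgm x) + (-(nOm k (sgm x) * nXi k (sgm x)) * nZs (sgm x) + nX k (sgm x) * (-(3 / 2 * (1 - sgm x ^ 2)))) / 5
  set P := 2 * sgm x * nX k (sgm x) + (1 + sgm x ^ 2) * (-(nOm k (sgm x) * nXi k (sgm x)))
  unfold fc
  have hw : (x 1 * ‖x‖⁻¹) ^ 2 + (x 2 * ‖x‖⁻¹) ^ 2 = 1 - sgm x ^ 2 / 2 := by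
    field_simp
    linarith
  have hxa : x 0 * ‖x‖⁻¹ = sgm x * (Real.sqrt 2)⁻¹ := by rw [hx0]; field_simp
  have hst : Real.sqrt 2 = 2 * (Real.sqrt 2)⁻¹ := by field_simp; exact hs2
  simp only [div_eq_mul_inv _ (Real.sqrt 2)]
  linear_combination (‖x‖⁻¹ * (Real.sqrt 2)⁻¹) * hode + B * ‖x‖⁻¹ * hst - B * sgm x * ‖x‖⁻¹ * hxa
    - (‖x‖⁻¹ * (Real.sqrt 2)⁻¹) * ((1 + sgm x ^ 2) * nX k (sgm x) + P * sgm x) * hw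

lemma sgm_abs (x : E3) : |sgm x| ≤ 2 := by
  have h1 : Real.sqrt 2 ≤ 2 := by
    rw [Real.sqrt_le_left (by norm_num)]; norm_num
  have h0 : 0 ≤ Real.sqrt 2 := Real.sqrt_nonneg 2
  unfold sgm
  rw [abs_div, abs_mul, abs_of_nonneg h0, abs_norm]
  refine div_le_of_le_mul₀ (norm_nonneg _) (by norm_num) ?_
  exact mul_le_mul h1 (coord_le x 0) (abs_nonneg _) (by norm_num)

lemma xn_abs (x : E3) (i : Fin 3) : |x i / ‖x‖| ≤ 1 := by
  rw [abs_div, abs_norm]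
  exact div_le_one_of_le₀ (coord_le x i) (norm_nonneg _)

lemma cont_bd {f : ℝ → ℝ} (hf : Continuous f) : ∃ C, 0 ≤ C ∧ ∀ x : E3, |f (sgm x)| ≤ C := by
  obtain ⟨C, hC⟩ := (isCompact_Icc (a := (-2 : ℝ)) (b := 2)).exists_bound_of_continuousOn hf.continuousOn
  have : ∀ x : E3, |f (sgm x)| ≤ C := fun x => hC _ (abs_le.1 (sgm_abs x))
  exact ⟨C, (abs_nonneg _).trans (this 0), this⟩

lemma XX_bd {k : ℝ} (hk : 5 / 2 ≤ k) : ∃ C, ∀ i, ∀ x : E3, |XX k x i| ≤ C := by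
  obtain ⟨C1, h1, hC1⟩ := cont_bd (fb_cd hk).continuous
  obtain ⟨C2, h2, hC2⟩ := cont_bd (fc_cd hk).continuous
  have hh : ∀ (i : Fin 3) (x : E3), |fc k (sgm x) * (x i * ‖x‖⁻¹)| ≤ C2 := by
    intro i x
    rw [abs_mul, ← div_eq_mul_inv]
    calc _ ≤ C2 * 1 := mul_le_mul (hC2 x) (xn_abs x i) (abs_nonneg _) h2
      _ = C2 := mul_one _
  refine ⟨max C1 C2, fun i x => ?_⟩
  fin_cases i
  · show |XX k x 0| ≤ _
    rw [XX_0]; exact (hC1 x).trans (le_max_left _ _)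
  · show |XX k x 1| ≤ _
    rw [XX_1]; exact (hh 1 x).trans (le_max_right _ _)
  · show |XX k x 2| ≤ _
    rw [XX_2]; exact (hh 2 x).trans (le_max_right _ _)

lemma norm_le_of_coord {x : E3} {C : ℝ} (h : ∀ i, |x i| ≤ C) : ‖x‖ ≤ 2 * C := by
  have h0 : 0 ≤ C := (abs_nonneg _).trans (h 0)
  refine abs_le_of_sq_le_sq' ?_ (by linarith) |>.2
  rw [norm3_sq]
  have hi : ∀ i, x i ^ 2 ≤ C ^ 2 := fun i => sq_le_sq' (abs_le.1 (h i)).1 (abs_le.1 (h i)).2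
  nlinarith [hi 0, hi 1, hi 2]

lemma gu_bd : ∃ C, ∀ x : E3, ‖gu x‖ ≤ C := by
  obtain ⟨C1, h1, hC1⟩ := cont_bd (f := nZs) (by unfold nZs; fun_prop)
  obtain ⟨C2, h2, hC2⟩ := cont_bd (f := fun σ => (1 + σ ^ 2) / Real.sqrt 2) (by fun_prop)
  have hh : ∀ (i : Fin 3) (x : E3), |(1 + sgm x ^ 2) / Real.sqrt 2 * (x i / ‖x‖)| ≤ C2 := by
    intro i x
    rw [abs_mul]
    calc _ ≤ C2 * 1 := mul_le_mul (hC2 x) (xn_abs x i) (abs_nonneg _) h2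
      _ = C2 := mul_one _
  refine ⟨2 * max C1 C2, fun x => norm_le_of_coord fun i => ?_⟩
  fin_cases i
  · show |gu x 0| ≤ _
    rw [gu_zero]; exact (hC1 x).trans (le_max_left _ _)
  · have e : gu x 1 = (1 + sgm x ^ 2) / Real.sqrt 2 * (x 1 / ‖x‖) := by simp [gu]
    show |gu x 1| ≤ _
    rw [e]; exact (hh 1 x).trans (le_max_right _ _)
  · have e : gu x 2 = (1 + sgm x ^ 2) / Real.sqrt 2 * (x 2 / ‖x‖) := by simp [gu]
    show |gu x 2| ≤ _
    rw [e]; exact (hh 2 x).trans (le_max_right _ _)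

lemma gu_cont : ContinuousOn gu {0}ᶜ := by
  intro x hx
  have hs : ContinuousAt sgm x := (sgm_cd hx).continuousAt
  have hn : ContinuousAt (fun y : E3 => ‖y‖) x := continuous_norm.continuousAt
  have hn0 : ‖x‖ ≠ 0 := norm_ne_zero_iff.2 hx
  have hc : ∀ i, ContinuousAt (fun y : E3 => (1 + sgm y ^ 2) / Real.sqrt 2 * (y i / ‖y‖)) x := fun i =>
    ((continuousAt_const.add (hs.pow 2)).div_const _).mul (((coord_fd i x).continuousAt).div hn hn0)
  refine ContinuousAt.continuousWithinAt ?_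
  have h : ContinuousAt (fun y : E3 => (![nZs (sgm y), (1 + sgm y ^ 2) / Real.sqrt 2 * (y 1 / ‖y‖),
      (1 + sgm y ^ 2) / Real.sqrt 2 * (y 2 / ‖y‖)] : Fin 3 → ℝ)) x := by
    rw [continuousAt_pi]
    intro i
    fin_cases i
    · have : Continuous nZs := by unfold nZs; fun_prop
      exact this.continuousAt.comp hs
    · exact hc 1
    · exact hc 2
  exact (PiLp.continuous_toLp 2 (fun _ : Fin 3 => ℝ)).continuousAt.comp h

lemma grad_cont {ψ : E3 → ℝ} (hψ : ContDiff ℝ 1 ψ) : Continuous (gradient ψ) := by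
  have h := hψ.continuous_fderiv (by simp)
  exact (InnerProductSpace.toDual ℝ E3).symm.continuous.comp h

lemma grad_coord (ψ : E3 → ℝ) (x : E3) (i : Fin 3) : fderiv ℝ ψ x (ej i) = gradient ψ x i := by
  have h : ⟪gradient ψ x, ej i⟫ = fderiv ℝ ψ x (ej i) := InnerProductSpace.toDual_symm_apply
  rw [← h, ej, EuclideanSpace.inner_single_right]; simp

lemma XX_weak {k : ℝ} (hk : 5 / 2 ≤ k) {ψ : E3 → ℝ} (hψ : ContDiff ℝ 1 ψ) (hc : HasCompactSupport ψ) :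
    ∫ x, ⟪XX k x, gradient ψ x⟫ = 0 := by
  obtain ⟨C, hC⟩ := XX_bd hk
  have h := div_free_int (f := fun i x => XX k x i) (f' := fun i => fderiv ℝ (fun y => XX k y i))
    (e := ej) (C := C) ej_norm
    (fun i x hx => ((XX_cd hk i hx).differentiableAt (by simp)).hasFDerivAt)
    (fun i x hx => ((XX_cd hk i hx).fderiv_right (m := 0) (by simp)).continuousAt)
    hC (fun x hx => XX_div hk hx) hψ hc
  rw [← h]
  congr 1
  ext x
  rw [inner3, Fin.sum_univ_three]
  simp only [grad_coord]

lemma G_int {k : ℝ} (hk : 5 / 2 ≤ k) (hk3 : k < 3) {v : E3 → E3} (hv : Continuous v) {C : ℝ}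
    (hb : ∀ x, ‖v x‖ ≤ C) : IntegrableOn (fun x => GG k (gu x + v x)) (ball 0 1) := by
  obtain ⟨C1, h1⟩ := gu_bd
  have hG : Continuous (GG k) := (GG_diff hk hk3).continuous
  obtain ⟨C2, h2⟩ := (isCompact_closedBall (0 : E3) (C1 + C)).exists_bound_of_continuousOn hG.continuousOn
  refine Measure.integrableOn_of_bounded (M := C2) measure_ball_lt_top.ne ?_ ?_
  · have := aesm_off_zero (f := fun x => GG k (gu x + v x))
      (hG.comp_continuousOn (gu_cont.add hv.continuousOn))
    exact this
  · refine Filter.Eventually.of_forall fun x => h2 _ ?_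
    rw [mem_closedBall, dist_zero_right]
    exact (norm_add_le _ _).trans (add_le_add (h1 x) (hb x))

lemma XX_int {k : ℝ} (hk : 5 / 2 ≤ k) {ψ : E3 → ℝ} (hψ : ContDiff ℝ 1 ψ) (hc : HasCompactSupport ψ) :
    Integrable (fun x => ⟪XX k x, gradient ψ x⟫) := by
  obtain ⟨C, hC⟩ := XX_bd hk
  have h : Integrable (fun x => ∑ i, XX k x i * fderiv ℝ ψ x (ej i)) :=
    integrable_finsetSum _ fun i _ => bdd_mul_int
      (fun x hx => ((XX_cd hk i hx).continuousAt).continuousWithinAt) (hC i)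
      (fderiv_app_cont hψ _) (fderiv_app_supp hc _)
  convert h using 2 with x
  rw [inner3, Fin.sum_univ_three]
  simp only [grad_coord]

lemma grad_off {ψ : E3 → ℝ} {x : E3} (hx : x ∉ tsupport ψ) : gradient ψ x = 0 := by
  have h : ψ =ᶠ[nhds x] fun _ => 0 := notMem_tsupport_iff_eventuallyEq.1 hx
  unfold gradient
  rw [h.fderiv_eq]; simp

lemma minim {k : ℝ} (hk : 5 / 2 ≤ k) (hk3 : k < 3) {ψ : E3 → ℝ} (hψ : ContDiff ℝ 1 ψ)
    (hc : HasCompactSupport ψ) (hs : tsupport ψ ⊆ ball (0 : E3) 1) :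
    ∫ x in ball (0 : E3) 1, GG k (gradient u0 x) ≤
      ∫ x in ball (0 : E3) 1, GG k (gradient u0 x + gradient ψ x) := by
  obtain ⟨M, hM0, hM1, hM2⟩ := exists_bd hψ hc
  have hgb : ∀ x, ‖gradient ψ x‖ ≤ M := fun x => by
    unfold gradient; rw [LinearIsometryEquiv.norm_map]; exact hM2 x
  have hae : ∀ᵐ x ∂(volume.restrict (ball (0 : E3) 1)), gradient u0 x = gu x ∧ x ≠ 0 := by
    refine ae_restrict_of_ae ?_
    have : ∀ᵐ x : E3, x ≠ 0 := Measure.ae_ne volume 0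
    filter_upwards [this] with x hx
    exact ⟨(u0_grad hx).gradient, hx⟩
  have e1 : ∫ x in ball (0 : E3) 1, GG k (gradient u0 x) = ∫ x in ball (0 : E3) 1, GG k (gu x) :=
    integral_congr_ae (by filter_upwards [hae] with x hx; rw [hx.1])
  have e2 : ∫ x in ball (0 : E3) 1, GG k (gradient u0 x + gradient ψ x) =
      ∫ x in ball (0 : E3) 1, GG k (gu x + gradient ψ x) :=
    integral_congr_ae (by filter_upwards [hae] with x hx; rw [hx.1])
  have e3 : ∫ x in ball (0 : E3) 1, ⟪XX k x, gradient ψ x⟫ = 0 := by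
    rw [setIntegral_eq_integral_of_forall_compl_eq_zero, XX_weak hk hψ hc]
    intro x hx
    rw [grad_off (fun h => hx (hs h)), inner_zero_right]
  have i1 : IntegrableOn (fun x => GG k (gu x)) (ball 0 1) := by
    simpa using G_int hk hk3 (v := fun _ => 0) continuous_const (C := 0) (by simp)
  have i2 := G_int hk hk3 (grad_cont hψ) hgb
  have i3 : IntegrableOn (fun x => ⟪XX k x, gradient ψ x⟫) (ball 0 1) := (XX_int hk hψ hc).integrableOn
  rw [e1, e2]
  calc ∫ x in ball (0 : E3) 1, GG k (gu x)
      = ∫ x in ball (0 : E3) 1, (GG k (gu x) + ⟪XX k x, gradient ψ x⟫) := by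
        rw [integral_add i1 i3, e3, add_zero]
    _ ≤ _ := by
        refine integral_mono_ae (i1.add i3) i2 ?_
        filter_upwards [hae] with x hx
        have := GG_subgrad' hk hk3 (gu x) (gu x + gradient ψ x)
        rw [Hg_gu hk hk3 hx.2, add_sub_cancel_left] at this
        exact this

/-- For every `δ ∈ (0,1)` there are a convex `C^{1,1-δ}_loc` function `G₀` on `ℝ³`, affine on
each of two disjoint compact convex sets `A₁, A₂` containing `∇u₀(K₀)` and smooth with positive
definite Hessian off `A₁ ∪ A₂`, such that `u₀` minimizes `∫_{B₁} G₀(∇u₀) dx`. -/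
theorem statement2 (δ : ℝ) (hδ : δ ∈ Set.Ioo (0 : ℝ) 1) :
    ∃ (G₀ : EuclideanSpace ℝ (Fin 3) → ℝ) (A₁ A₂ : Set (EuclideanSpace ℝ (Fin 3))),
      ConvexOn ℝ Set.univ G₀ ∧
      Differentiable ℝ G₀ ∧
      (∀ s : Set (EuclideanSpace ℝ (Fin 3)), Bornology.IsBounded s →
        ∃ C : ℝ, ∀ x ∈ s, ∀ y ∈ s,
          ‖gradient G₀ x - gradient G₀ y‖ ≤ C * ‖x - y‖ ^ (1 - δ)) ∧
      IsCompact A₁ ∧ IsCompact A₂ ∧ Convex ℝ A₁ ∧ Convex ℝ A₂ ∧ Disjoint A₁ A₂ ∧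
      {p : EuclideanSpace ℝ (Fin 3) | ∃ x : EuclideanSpace ℝ (Fin 3),
          x ≠ 0 ∧ (x 1) ^ 2 + (x 2) ^ 2 < (x 0) ^ 2 ∧ gradient u0 x = p} ⊆ A₁ ∪ A₂ ∧
      (∃ (v₁ : EuclideanSpace ℝ (Fin 3)) (c₁ : ℝ), ∀ p ∈ A₁, G₀ p = ⟪v₁, p⟫ + c₁) ∧
      (∃ (v₂ : EuclideanSpace ℝ (Fin 3)) (c₂ : ℝ), ∀ p ∈ A₂, G₀ p = ⟪v₂, p⟫ + c₂) ∧
      (∀ p ∉ A₁ ∪ A₂, ContDiffAt ℝ (⊤ : ℕ∞) G₀ p ∧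
        ∀ ξ : EuclideanSpace ℝ (Fin 3), ξ ≠ 0 → 0 < iteratedFDeriv ℝ 2 G₀ p ![ξ, ξ]) ∧
      (∀ ψ : EuclideanSpace ℝ (Fin 3) → ℝ, ContDiff ℝ (⊤ : ℕ∞) ψ → HasCompactSupport ψ →
        tsupport ψ ⊆ ball (0 : EuclideanSpace ℝ (Fin 3)) 1 →
        ∫ x in ball (0 : EuclideanSpace ℝ (Fin 3)) 1, G₀ (gradient u0 x) ≤
          ∫ x in ball (0 : EuclideanSpace ℝ (Fin 3)) 1,
            G₀ (gradient u0 x + gradient ψ x)) := by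
  obtain ⟨hδ0, hδ1⟩ := hδ
  obtain ⟨k, hk, hk3, hkd⟩ : ∃ k : ℝ, 5 / 2 ≤ k ∧ k < 3 ∧ 1 - δ ≤ k / 3 := by
    refine ⟨max (3 - 3 * δ) (5 / 2), le_max_right _ _, max_lt (by linarith) (by norm_num), ?_⟩
    have := le_max_left (3 - 3 * δ) (5 / 2)
    linarith
  refine ⟨GG k, A1 k, A2 k, GG_convex hk hk3, GG_diff hk hk3, ?_, A1_compact hk, A2_compact hk,
    A1_convex hk, A2_convex hk, A_disjoint hk, K0_sub, ?_, ?_, ?_, ?_⟩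
  · intro s hs
    obtain ⟨R, hR⟩ := hs.subset_closedBall (0 : E3)
    obtain ⟨C, -, hC⟩ := Hg_hoelder hk hk3 (α := 1 - δ) (by linarith) hkd (R := max R 0) (le_max_right _ _)
    have hm : ∀ x ∈ s, ‖x‖ ≤ max R 0 := fun x hx => by
      have := hR hx
      rw [mem_closedBall, dist_zero_right] at this
      exact this.trans (le_max_left _ _)
    refine ⟨C, fun x hx y hy => ?_⟩
    rw [GG_gradient hk hk3, GG_gradient hk hk3]
    exact hC x y (hm x hx) (hm y hy)
  · exact ⟨_, _, fun p hp => GG_edge hk (sg_A1 hk hk3 hp) (by simp)⟩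
  · exact ⟨_, _, fun p hp => GG_edge hk (sg_A2 hk hk3 hp) (by simp)⟩
  · exact fun p hp => ⟨GG_smooth hk hk3 hp, fun ξ hξ => GG_hess hk hk3 hp hξ⟩
  · intro ψ hψ hc hs
    exact minim hk hk3 (hψ.of_le (by exact_mod_cast le_top)) hc hs
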